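/- arXiv:math/0610343 — 2 statements merged into one kernel-verified Lean document; each statement's English description precedes it below -/
import Mathlib

section
/- Let K = {z ∈ ℂ : the orbit (f^n(z))_{n≥0} is bounded} be the filled Julia set of the basilica polynomial f, and let ℛ be the connected component of K ∖ {α} containing 0. For every n ≥ 2, the number of bubbles of f of generation n that are contained in ℛ is equal to the degree of the rational function ξ_n, namely (2^n − (−1)^n)/3. -/
open Filter Topology

/-- The basilica polynomial `f(z) = z² − 1`. -/
noncomputable def fBasilica : ℂ → ℂ := fun z => z ^ 2 - 1

/-- The basin of attraction of the superattracting 2-cycle `0 ↦ −1 ↦ 0`. -/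
def basilicaBasin : Set ℂ :=
  {z | Tendsto (fun n => fBasilica^[2 * n] z) atTop (𝓝 0) ∨
       Tendsto (fun n => fBasilica^[2 * n] z) atTop (𝓝 (-1))}

/-- A bubble is a connected component of the basin. -/
def IsBubble (F : Set ℂ) : Prop :=
  ∃ z ∈ basilicaBasin, F = connectedComponentIn basilicaBasin z

/-- The bubble containing `0`. -/
noncomputable def B0 : Set ℂ := connectedComponentIn basilicaBasin 0

/-- The generation of a bubble: the least `n ≥ 0` with `f^[n] '' F ⊆ B0`. -/
noncomputable def bubbleGen (F : Set ℂ) : ℕ := sInf {n : ℕ | fBasilica^[n] '' F ⊆ B0}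

/-- The dividing (α) fixed point of the basilica, `α = (1 − √5)/2`. -/
noncomputable def alphaFix : ℂ := ((1 - Real.sqrt 5 : ℝ) : ℂ) / 2

/-- The filled Julia set of the basilica: points with bounded orbit. -/
def filledJulia : Set ℂ :=
  {z | Bornology.IsBounded (Set.range fun n => fBasilica^[n] z)}

/-- The "right half" of the basilica: the connected component of `K ∖ {α}` containing `0`. -/
noncomputable def rightBasilica : Set ℂ :=
  connectedComponentIn (filledJulia \ {alphaFix}) 0

/-- `ξ_n(a) = R_a^n(−1)` as a rational function of the parameter `a`:
`ξ_0 = −1` and `ξ_{n+1} = a / (ξ_n² + 2·ξ_n)`, so that `ξ_1 = −a`. -/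
noncomputable def xiFun : ℕ → RatFunc ℂ
  | 0 => -1
  | n + 1 => RatFunc.X / (xiFun n ^ 2 + 2 * xiFun n)

/-- The degree of a rational function: the maximum of the degrees of its numerator and
denominator (in lowest terms). -/
noncomputable def ratDegree (r : RatFunc ℂ) : ℕ := max r.num.natDegree r.denom.natDegree

open Polynomial in
lemma ratDegree_of_coprime {r : RatFunc ℂ} {P Q : ℂ[X]} (hQ : Q ≠ 0) (hc : IsCoprime P Q)
    (h : r * algebraMap _ _ Q = algebraMap _ _ P) : ratDegree r = max P.natDegree Q.natDegree := by
  have hQ' : (algebraMap ℂ[X] (RatFunc ℂ) Q) ≠ 0 := by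
    simpa using hQ
  have hr : r = algebraMap _ _ P / algebraMap _ _ Q := by
    field_simp; exact h
  have e := (RatFunc.num_mul_eq_mul_denom_iff (x := r) hQ).2 hr
  have hnd := RatFunc.isCoprime_num_denom r
  have a1 : Associated r.num P := by
    apply associated_of_dvd_dvd
    · exact hnd.dvd_of_dvd_mul_right ⟨Q, e.symm⟩
    · exact hc.dvd_of_dvd_mul_right ⟨r.denom, e⟩
  have a2 : Associated r.denom Q := by
    apply associated_of_dvd_dvd
    · exact hnd.symm.dvd_of_dvd_mul_left ⟨P, by rw [e, mul_comm]⟩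
    · exact hc.symm.dvd_of_dvd_mul_left ⟨r.num, by rw [← e, mul_comm]⟩
  unfold ratDegree
  rw [natDegree_eq_of_degree_eq (degree_eq_degree_of_associated a1),
    natDegree_eq_of_degree_eq (degree_eq_degree_of_associated a2)]

open Polynomial in
lemma isCoprime_X_of_eval {P : ℂ[X]} (h : P.eval 0 ≠ 0) : IsCoprime (X : ℂ[X]) P := by
  have : ¬ (X : ℂ[X]) ∣ P := by
    rw [X_dvd_iff, coeff_zero_eq_eval_zero]; exact h
  exact (irreducible_X.coprime_iff_not_dvd).2 this

open Polynomial in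
/-- Explicit data describing `ξ_{2k+1} = X P / Q`. -/
def XiOdd (k d : ℕ) (P Q : ℂ[X]) (u : ℝ) : Prop :=
  xiFun (2 * k + 1) * algebraMap _ _ Q = algebraMap _ _ (X * P) ∧ IsCoprime (X * P) Q ∧
  Q.eval 0 ≠ 0 ∧ u ≤ -1 ∧ P.eval 0 = u * Q.eval 0 ∧ P.natDegree = d ∧ Q.natDegree ≤ d ∧
  3 * (d + 1) = 2 ^ (2 * k + 1) + 1

open Polynomial in
lemma xi_even {k d : ℕ} {P Q : ℂ[X]} {u : ℝ} (h : XiOdd k d P Q u) :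
    xiFun (2 * k + 2) * algebraMap _ _ (P * (X * P + 2 * Q)) = algebraMap _ _ (Q ^ 2) ∧
    IsCoprime (Q ^ 2) (P * (X * P + 2 * Q)) ∧ (P * (X * P + 2 * Q)).natDegree = 2 * d + 1 ∧
    (Q ^ 2).natDegree ≤ 2 * d := by
  obtain ⟨h1, h2, h3, h4, h5, h6, h7, h8⟩ := h
  have hQ : Q ≠ 0 := by rintro rfl; simp at h3
  have hP0 : P.eval 0 ≠ 0 := by
    rw [h5]; refine mul_ne_zero ?_ h3
    exact_mod_cast (by linarith : u < 0).ne
  have hP : P ≠ 0 := by rintro rfl; simp at hP0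
  have hdeg : (X * P + 2 * Q).natDegree = d + 1 := by
    have e1 : (X * P).natDegree = d + 1 := by rw [natDegree_X_mul hP, h6]
    have e2 : (2 * Q).natDegree ≤ d := by
      refine (natDegree_mul_le).trans ?_
      have : (2 : ℂ[X]).natDegree = 0 := natDegree_ofNat 2
      omega
    rw [natDegree_add_eq_left_of_natDegree_lt (by omega), e1]
  have hS : X * P + 2 * Q ≠ 0 := by
    intro h; rw [h] at hdeg; simp at hdeg
  refine ⟨?_, ?_, ?_, ?_⟩
  · have hQ' : (algebraMap ℂ[X] (RatFunc ℂ) Q) ≠ 0 := by simpa using hQ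
    have hP' : (algebraMap ℂ[X] (RatFunc ℂ) P) ≠ 0 := by simpa using hP
    have hX' : (RatFunc.X : RatFunc ℂ) ≠ 0 := RatFunc.X_ne_zero
    have hS' : (algebraMap ℂ[X] (RatFunc ℂ) (X * P + 2 * Q)) ≠ 0 := by
      simpa only [ne_eq, FaithfulSMul.algebraMap_eq_zero_iff] using hS
    simp only [map_mul, map_add, map_pow, RatFunc.algebraMap_X, map_ofNat] at h1 hS' ⊢
    have hx : xiFun (2 * k + 1) = RatFunc.X * algebraMap _ _ P / algebraMap _ _ Q := by
      field_simp; exact h1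
    rw [show 2 * k + 2 = (2 * k + 1) + 1 from rfl, xiFun, hx]
    generalize algebraMap ℂ[X] (RatFunc ℂ) P = p at *
    generalize algebraMap ℂ[X] (RatFunc ℂ) Q = q at *
    have : (RatFunc.X * p / q) ^ 2 + 2 * (RatFunc.X * p / q) =
      RatFunc.X * p * (RatFunc.X * p + 2 * q) / q ^ 2 := by field_simp
    rw [this]; field_simp
  · have c1 : IsCoprime Q P := (IsCoprime.of_mul_left_right h2).symm
    refine IsCoprime.pow_left (c1.mul_right ?_)
    have := h2.symm.add_mul_left_right 2
    rwa [mul_comm Q 2] at this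
  · rw [natDegree_mul hP hS, hdeg, h6]; ring
  · rw [natDegree_pow]; omega

open Polynomial in
lemma xi_odd (k : ℕ) : ∃ d P Q u, XiOdd k d P Q u := by
  induction k with
  | zero =>
    refine ⟨0, -1, 1, -1, ?_, ?_, ?_, ?_, ?_, ?_, ?_, ?_⟩
    · have e : xiFun (2 * 0 + 1) = RatFunc.X / ((-1) ^ 2 + 2 * (-1)) := rfl
      have e2 : ((-1) ^ 2 + 2 * (-1) : RatFunc ℂ) = -1 := by ring
      rw [e, e2, map_one, map_mul, map_neg, map_one, RatFunc.algebraMap_X, mul_one, mul_neg_one,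
        div_eq_iff (by simp)]
      ring
    · exact isCoprime_one_right
    all_goals simp
  | succ k ih =>
    obtain ⟨d, P, Q, u, h⟩ := ih
    have he := xi_even h
    obtain ⟨h1, h2, h3, h4, h5, h6, h7, h8⟩ := h
    obtain ⟨g1, g2, g3, g4⟩ := he
    set S := P * (X * P + 2 * Q) with hSdef
    have hS0 : S.eval 0 = 2 * u * (Q.eval 0) ^ 2 := by
      simp [hSdef, h5]; ring
    set T := Q ^ 2 with hT
    have hT0 : T.eval 0 = (Q.eval 0) ^ 2 := by simp [hT]
    have hT0' : T.eval 0 ≠ 0 := by rw [hT0]; exact pow_ne_zero _ h3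
    have hu : (1 + 4 * u : ℝ) < 0 := by linarith
    have hu' : (1 + 4 * u : ℂ) ≠ 0 := by exact_mod_cast hu.ne
    have hTS0 : (T + 2 * S).eval 0 = (1 + 4 * u) * (Q.eval 0) ^ 2 := by
      simp [hS0, hT0]; ring
    have hTS0' : (T + 2 * S).eval 0 ≠ 0 := by
      rw [hTS0]; exact mul_ne_zero hu' (pow_ne_zero _ h3)
    have hS : S ≠ 0 := by intro h; rw [h] at g3; simp at g3
    refine ⟨2 * (2 * d + 1), S ^ 2, T * (T + 2 * S), 4 * u ^ 2 / (1 + 4 * u), ?_, ?_, ?_, ?_, ?_, ?_, ?_, ?_⟩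
    · have hTne : T ≠ 0 := by rintro h; simp [h] at hT0'
      have hTSne : T + 2 * S ≠ 0 := by intro h; rw [h] at hTS0'; simp at hTS0'
      have hS' : (algebraMap ℂ[X] (RatFunc ℂ) S) ≠ 0 := by simpa using hS
      have hT' : (algebraMap ℂ[X] (RatFunc ℂ) T) ≠ 0 := by simpa using hTne
      have hTS' : (algebraMap ℂ[X] (RatFunc ℂ) (T + 2 * S)) ≠ 0 := by
        simpa only [ne_eq, FaithfulSMul.algebraMap_eq_zero_iff] using hTSne
      rw [show 2 * (k + 1) + 1 = (2 * k + 2) + 1 from rfl, xiFun]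
      have hx : xiFun (2 * k + 2) = algebraMap _ _ T / algebraMap _ _ S := by
        field_simp; exact g1
      rw [hx]
      simp only [map_mul, map_add, map_pow, RatFunc.algebraMap_X, map_ofNat] at hTS' ⊢
      generalize algebraMap ℂ[X] (RatFunc ℂ) T = p at *
      generalize algebraMap ℂ[X] (RatFunc ℂ) S = q at *
      have : (p / q) ^ 2 + 2 * (p / q) = p * (p + 2 * q) / q ^ 2 := by field_simp
      rw [this]; field_simp
    · have c2 : IsCoprime S (T + 2 * S) := by
        have := g2.symm.add_mul_left_right 2
        rwa [mul_comm S 2] at this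
      exact IsCoprime.mul_left
        (IsCoprime.mul_right (isCoprime_X_of_eval hT0') (isCoprime_X_of_eval hTS0'))
        (IsCoprime.pow_left (IsCoprime.mul_right g2.symm c2))
    · rw [eval_mul]; exact mul_ne_zero hT0' hTS0'
    · rw [div_le_iff_of_neg hu]; nlinarith [sq_nonneg (2 * u + 1)]
    · rw [eval_pow, eval_mul (p := T), hTS0, hS0, hT0]; push_cast
      generalize (u : ℂ) = c at *
      have hc : 1 + c * 4 ≠ 0 := by rwa [mul_comm c 4]
      field_simp
      ring
    · rw [natDegree_pow, g3]
    · have e2 : (2 * S).natDegree ≤ 2 * d + 1 := by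
        refine (natDegree_mul_le).trans ?_
        have : (2 : ℂ[X]).natDegree = 0 := natDegree_ofNat 2
        omega
      have e3 : (T + 2 * S).natDegree ≤ 2 * d + 1 := natDegree_add_le_of_degree_le (by omega) e2
      refine (natDegree_mul_le).trans ?_
      omega
    · have : 2 ^ (2 * (k + 1) + 1) = 4 * 2 ^ (2 * k + 1) := by ring
      omega

lemma ratDegree_xi (n : ℕ) (hn : 1 ≤ n) : (3 * ratDegree (xiFun n) : ℤ) = 2 ^ n - (-1) ^ n := by
  rcases Nat.even_or_odd' n with ⟨m, rfl | rfl⟩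
  · obtain ⟨k, rfl⟩ : ∃ k, m = k + 1 := ⟨m - 1, by omega⟩
    obtain ⟨d, P, Q, u, h⟩ := xi_odd k
    obtain ⟨g1, g2, g3, g4⟩ := xi_even h
    have h8 := h.2.2.2.2.2.2.2
    have hS : P * (Polynomial.X * P + 2 * Q) ≠ 0 := by
      intro h; rw [h] at g3; simp at g3
    rw [show 2 * (k + 1) = 2 * k + 2 from rfl, ratDegree_of_coprime hS g2 g1, g3,
      max_eq_right (by omega)]
    have : ((-1 : ℤ)) ^ (2 * k + 2) = 1 := Even.neg_one_pow ⟨k + 1, by ring⟩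
    rw [this]; zify at h8; push_cast
    have : (2 : ℤ) ^ (2 * k + 2) = 2 * 2 ^ (2 * k + 1) := by ring
    linarith
  · obtain ⟨d, P, Q, u, h1, h2, h3, h4, h5, h6, h7, h8⟩ := xi_odd m
    have hQ : Q ≠ 0 := by rintro rfl; simp at h3
    have hP : P ≠ 0 := by
      rintro rfl
      simp only [Polynomial.eval_zero] at h5
      have := (mul_eq_zero.1 h5.symm).resolve_right h3
      have : u = 0 := by exact_mod_cast this
      linarith
    rw [ratDegree_of_coprime hQ h2 h1, Polynomial.natDegree_X_mul hP, h6, max_eq_left (by omega)]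
    have : ((-1 : ℤ)) ^ (2 * m + 1) = -1 := Odd.neg_one_pow ⟨m, rfl⟩
    rw [this]; zify at h8; push_cast; linarith

lemma fB_apply (z : ℂ) : fBasilica z = z ^ 2 - 1 := rfl

lemma fB_neg (z : ℂ) : fBasilica (-z) = fBasilica z := by simp [fB_apply]

lemma fB_cont : Continuous fBasilica := by unfold fBasilica; fun_prop

lemma fB_iter_cont (n : ℕ) : Continuous (fBasilica^[n]) := fB_cont.iterate n

lemma fB_eq_iff {z w : ℂ} (h : fBasilica z = fBasilica w) : z = w ∨ z = -w := by
  simp only [fB_apply] at h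
  exact sq_eq_sq_iff_eq_or_eq_neg.1 (by linear_combination h)

lemma fB_open : IsOpenMap fBasilica := by
  have h : AnalyticOnNhd ℂ fBasilica Set.univ := by
    apply DifferentiableOn.analyticOnNhd _ isOpen_univ
    unfold fBasilica; fun_prop
  rcases h.is_constant_or_isOpenMap with ⟨w, hw⟩ | h
  · have h0 := hw 0
    have h1 := hw 1
    rw [← h0] at h1; simp [fB_apply] at h1
  · exact h

lemma mem_K_def {z : ℂ} : z ∈ filledJulia ↔
    Bornology.IsBounded (Set.range fun n => fBasilica^[n] z) := Iff.rfl

lemma mem_K_f {z : ℂ} : fBasilica z ∈ filledJulia ↔ z ∈ filledJulia := by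
  have : (Set.range fun n => fBasilica^[n] z) =
      insert z (Set.range fun n => fBasilica^[n] (fBasilica z)) := by
    ext w
    simp only [Set.mem_range, Set.mem_insert_iff]
    constructor
    · rintro ⟨n, rfl⟩
      cases n with
      | zero => left; rfl
      | succ n => right; exact ⟨n, rfl⟩
    · rintro (rfl | ⟨n, rfl⟩)
      · exact ⟨0, rfl⟩
      · exact ⟨n + 1, rfl⟩
  simp only [mem_K_def, this, Bornology.isBounded_insert]

lemma mem_K_iter {z : ℂ} (h : z ∈ filledJulia) (n : ℕ) : fBasilica^[n] z ∈ filledJulia := by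
  induction n with
  | zero => exact h
  | succ n ih => rw [Function.iterate_succ_apply']; exact mem_K_f.2 ih

lemma K_norm_lt {z : ℂ} (h : z ∈ filledJulia) : ‖z‖ < 2 := by
  by_contra hz
  push Not at hz
  have key : ∀ n : ℕ, 2 * (3 / 2 : ℝ) ^ n ≤ ‖fBasilica^[n] z‖ := by
    intro n
    induction n with
    | zero => simpa using hz
    | succ n ih =>
      rw [Function.iterate_succ_apply', fB_apply]
      set w := fBasilica^[n] z
      have h1 : ‖w‖ ^ 2 - 1 ≤ ‖w ^ 2 - 1‖ := by
        have := norm_sub_norm_le (w ^ 2) 1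
        simpa using this
      have h2 : (1 : ℝ) ≤ (3 / 2) ^ n := one_le_pow₀ (by norm_num)
      rw [pow_succ]
      nlinarith
  obtain ⟨C, hC⟩ := (isBounded_iff_forall_norm_le.1 (mem_K_def.1 h))
  obtain ⟨n, hn⟩ := pow_unbounded_of_one_lt C (by norm_num : (1 : ℝ) < 3 / 2)
  have := hC _ ⟨n, rfl⟩
  have := key n
  simp only at *
  have : (0 : ℝ) < (3 / 2) ^ n := by positivity
  linarith

/-- The real number `α`. -/
noncomputable def aR : ℝ := (1 - Real.sqrt 5) / 2

lemma aR_sq : aR ^ 2 = aR + 1 := by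
  have : Real.sqrt 5 ^ 2 = 5 := Real.sq_sqrt (by norm_num)
  unfold aR; linear_combination this / 4

lemma aR_lt : aR < -0.618 := by
  have : 2.236 < Real.sqrt 5 := by
    rw [Real.lt_sqrt (by norm_num)]; norm_num
  unfold aR; linarith

lemma lt_aR : -0.6185 < aR := by
  have : Real.sqrt 5 < 2.237 := by
    rw [Real.sqrt_lt' (by norm_num)]; norm_num
  unfold aR; linarith

lemma alpha_eq : alphaFix = (aR : ℂ) := by
  unfold alphaFix aR; push_cast; ring

lemma f_alpha : fBasilica alphaFix = alphaFix := by
  rw [fB_apply, alpha_eq]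
  have : (aR : ℂ) ^ 2 = aR + 1 := by exact_mod_cast aR_sq
  rw [this]; ring

lemma f_re (z : ℂ) : (fBasilica z).re = z.re ^ 2 - z.im ^ 2 - 1 := by
  simp [fB_apply, pow_two]

lemma f_im (z : ℂ) : (fBasilica z).im = 2 * z.re * z.im := by
  simp [fB_apply, pow_two]; ring

/-- Forward invariant (relative to `K`) region around the vertical line through `α`. -/
def TT : Set ℂ := {z | 0 ≤ aR - z.re ∧ -2 * aR * (aR - z.re) + (aR - z.re) ^ 2 ≤ z.im ^ 2}

lemma num_ineq {a X' Y' p Y'' : ℝ} (ha1 : a < -0.618) (ha2 : -0.6185 < a) (hX' : 0 ≤ X')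
    (hY' : 1.52 * X' ≤ Y') (hp : p = -2 * a * X' + X' ^ 2 - Y') (hp0 : 0 < p)
    (hY'' : Y'' = Y' * (2 * (a - X')) ^ 2) (h4 : Y'' < 4)
    (h5 : -2 < a - (Y'' - 2 * a * p - p ^ 2)) : False := by
  have hXpos : 0 < X' := by
    rcases hX'.lt_or_eq with h | h
    · exact h
    · subst h; nlinarith
  have h1 : 0.283 < X' := by
    by_contra h
    push Not at h
    nlinarith
  have h2 : 0.43 ≤ Y' := by linarith
  have h3 : (1.802 : ℝ) ^ 2 ≤ (2 * (a - X')) ^ 2 := by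
    nlinarith
  rcases le_or_gt p (-2 * a) with h | h
  · have : 0 ≤ - 2 * a * p - p ^ 2 := by nlinarith
    have : 0.43 * (1.802 : ℝ) ^ 2 ≤ Y'' := by rw [hY'']; gcongr
    norm_num at this
    linarith
  · have h6 : 1.2 < X' := by
      by_contra h
      push Not at h
      nlinarith
    have h7 : (3.6 : ℝ) ^ 2 ≤ (2 * (a - X')) ^ 2 := by nlinarith
    have : 1.8 * (3.6 : ℝ) ^ 2 ≤ Y'' := by
      rw [hY'']
      have : 1.8 ≤ Y' := by linarith
      gcongr
    norm_num at this
    linarith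

lemma TT_step {z : ℂ} (hK : z ∈ filledJulia) (hT : z ∈ TT) :
    fBasilica z ∈ TT ∧ 1.5 * z.im ^ 2 ≤ (fBasilica z).im ^ 2 := by
  obtain ⟨h1, h2⟩ := hT
  have ha1 := aR_lt
  have ha2 := lt_aR
  have hsq := aR_sq
  have hre : aR - (fBasilica z).re = z.im ^ 2 - (-2 * aR * (aR - z.re) + (aR - z.re) ^ 2) := by
    rw [f_re]; linear_combination -hsq
  have hx2 : 0.38 ≤ z.re ^ 2 := by nlinarith
  have him : 1.52 * z.im ^ 2 ≤ (fBasilica z).im ^ 2 := by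
    rw [f_im]; nlinarith [sq_nonneg z.im]
  refine ⟨⟨by rw [hre]; linarith, ?_⟩, by nlinarith [sq_nonneg z.im]⟩
  by_contra hcon
  push Not at hcon
  have hu : 0 ≤ -2 * aR * (aR - z.re) + (aR - z.re) ^ 2 := by nlinarith
  set w := fBasilica z with hw
  set v := fBasilica w with hv
  have hvK : v ∈ filledJulia := mem_K_f.2 (mem_K_f.2 hK)
  have hv4 : v.im ^ 2 < 4 := by
    have := (Complex.abs_im_le_norm v).trans_lt (K_norm_lt hvK)
    have h0 := abs_lt.1 this
    nlinarith
  have hfv := K_norm_lt (mem_K_f.2 hvK)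
  have hfv2 : -2 < (fBasilica v).re := (abs_lt.1 ((Complex.abs_re_le_norm _).trans_lt hfv)).1
  have hvre : aR - v.re = w.im ^ 2 - (-2 * aR * (aR - w.re) + (aR - w.re) ^ 2) := by
    rw [hv, f_re]; linear_combination -hsq
  refine num_ineq (a := aR) (X' := aR - w.re) (Y' := w.im ^ 2) (p := v.re - aR) (Y'' := v.im ^ 2)
    ha1 ha2 (by rw [hre]; linarith) (by rw [hre]; linarith) (by linarith) (by linarith) ?_ hv4 ?_
  · rw [hv, f_im]; ring
  · rw [f_re] at hfv2; nlinarith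

lemma K_vertical {z : ℂ} (hK : z ∈ filledJulia) (hre : z.re = aR) : z = alphaFix := by
  have hT : z ∈ TT := by
    refine ⟨by simp [hre], ?_⟩
    rw [hre]; simp; positivity
  have key : ∀ n : ℕ, fBasilica^[n] z ∈ TT ∧ 1.5 ^ n * z.im ^ 2 ≤ (fBasilica^[n] z).im ^ 2 := by
    intro n
    induction n with
    | zero => exact ⟨hT, by simp⟩
    | succ n ih =>
      have := TT_step (mem_K_iter hK n) ih.1
      rw [Function.iterate_succ_apply']
      refine ⟨this.1, le_trans ?_ this.2⟩
      rw [pow_succ]; nlinarith [ih.2]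
  have him : z.im = 0 := by
    by_contra h
    have hpos : 0 < z.im ^ 2 := by positivity
    obtain ⟨n, hn⟩ := pow_unbounded_of_one_lt (4 / z.im ^ 2) (by norm_num : (1 : ℝ) < 1.5)
    rw [div_lt_iff₀ hpos] at hn
    have h1 := (key n).2
    have h2 := (Complex.abs_im_le_norm _).trans_lt (K_norm_lt (mem_K_iter hK n))
    have h3 := abs_lt.1 h2
    nlinarith
  rw [alpha_eq]; apply Complex.ext <;> simp [hre, him]

/-- The punctured filled Julia set. -/
def KA : Set ℂ := filledJulia \ {alphaFix}

/-- The left half of the basilica. -/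
noncomputable def leftB : Set ℂ := connectedComponentIn KA (-1)

lemma right_eq : rightBasilica = connectedComponentIn KA 0 := rfl

lemma segK {x : ℝ} (hx : |x| ≤ 1) : (x : ℂ) ∈ filledJulia := by
  have key : ∀ n : ℕ, ∃ y : ℝ, |y| ≤ 1 ∧ fBasilica^[n] (x : ℂ) = y := by
    intro n
    induction n with
    | zero => exact ⟨x, hx, rfl⟩
    | succ n ih =>
      obtain ⟨y, hy, e⟩ := ih
      refine ⟨y ^ 2 - 1, ?_, ?_⟩
      · rw [abs_le] at hy ⊢; constructor <;> nlinarith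
      · rw [Function.iterate_succ_apply', e, fB_apply]; push_cast; rfl
  refine mem_K_def.2 (isBounded_iff_forall_norm_le.2 ⟨1, ?_⟩)
  rintro _ ⟨n, rfl⟩
  obtain ⟨y, hy, e⟩ := key n
  simp only [e]
  simpa using hy

lemma zero_KA : (0 : ℂ) ∈ KA := by
  refine ⟨by simpa using segK (x := 0) (by simp), ?_⟩
  rw [Set.mem_singleton_iff, alpha_eq]
  have := aR_lt
  intro h
  have h' : (0 : ℝ) = aR := by exact_mod_cast h
  linarith

lemma neg_one_KA : (-1 : ℂ) ∈ KA := by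
  refine ⟨by simpa using segK (x := -1) (by simp), ?_⟩
  rw [Set.mem_singleton_iff, alpha_eq]
  have := lt_aR
  intro h
  have h' : (-1 : ℝ) = aR := by exact_mod_cast h
  linarith

lemma zero_R : (0 : ℂ) ∈ rightBasilica := mem_connectedComponentIn zero_KA
lemma neg_one_L : (-1 : ℂ) ∈ leftB := mem_connectedComponentIn neg_one_KA
lemma R_KA : rightBasilica ⊆ KA := connectedComponentIn_subset _ _
lemma L_KA : leftB ⊆ KA := connectedComponentIn_subset _ _
lemma R_conn : IsPreconnected rightBasilica := isPreconnected_connectedComponentIn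
lemma L_conn : IsPreconnected leftB := isPreconnected_connectedComponentIn

lemma sub_R {s : Set ℂ} (hs : IsPreconnected s) (hK : s ⊆ KA) {x : ℂ} (hx : x ∈ s)
    (hxR : x ∈ rightBasilica) : s ⊆ rightBasilica := by
  rw [right_eq] at *
  rw [connectedComponentIn_eq hxR]
  exact hs.subset_connectedComponentIn hx hK

lemma sub_L {s : Set ℂ} (hs : IsPreconnected s) (hK : s ⊆ KA) {x : ℂ} (hx : x ∈ s)
    (hxL : x ∈ leftB) : s ⊆ leftB := by
  unfold leftB at *
  rw [connectedComponentIn_eq hxL]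
  exact hs.subset_connectedComponentIn hx hK

lemma KA_re {z : ℂ} (hz : z ∈ KA) : z.re ≠ aR := fun h => hz.2 (K_vertical hz.1 h)

lemma R_re {z : ℂ} (hz : z ∈ rightBasilica) : aR < z.re := by
  by_contra h
  push Not at h
  have := (R_conn.image Complex.re Complex.continuous_re.continuousOn).ordConnected
  have h2 := this.out ⟨z, hz, rfl⟩ ⟨0, zero_R, rfl⟩
  obtain ⟨w, hw, e⟩ := h2 ⟨h, by have := aR_lt; simp; linarith⟩
  exact KA_re (R_KA hw) e

lemma L_re {z : ℂ} (hz : z ∈ leftB) : z.re < aR := by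
  by_contra h
  push Not at h
  have := (L_conn.image Complex.re Complex.continuous_re.continuousOn).ordConnected
  have h2 := this.out ⟨-1, neg_one_L, rfl⟩ ⟨z, hz, rfl⟩
  obtain ⟨w, hw, e⟩ := h2 ⟨by have := lt_aR; simp; linarith, h⟩
  exact KA_re (L_KA hw) e

lemma L_R_disj {z : ℂ} (h1 : z ∈ leftB) (h2 : z ∈ rightBasilica) : False :=
  lt_asymm (L_re h1) (R_re h2)

lemma one_R : (1 : ℂ) ∈ rightBasilica := by
  have hs : IsPreconnected ((fun x : ℝ => (x : ℂ)) '' Set.Icc 0 1) :=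
    isPreconnected_Icc.image _ Complex.continuous_ofReal.continuousOn
  refine sub_R hs ?_ (x := 0) ⟨0, by simp, by simp⟩ zero_R ⟨1, by simp, by simp⟩
  rintro _ ⟨x, ⟨hx0, hx1⟩, rfl⟩
  refine ⟨segK (abs_le.2 ⟨by linarith, hx1⟩), ?_⟩
  rw [Set.mem_singleton_iff, alpha_eq]
  have := aR_lt
  intro h
  simp only at h
  have h' : x = aR := by exact_mod_cast h
  linarith

/-- Preimage of a connected set containing the critical value is connected. -/
lemma preimage_conn {s : Set ℂ} (hs : IsPreconnected s) (h1 : (-1 : ℂ) ∈ s) :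
    IsPreconnected (fBasilica ⁻¹' s) := by
  have main : ∀ u v : Set ℂ, IsOpen u → IsOpen v → fBasilica ⁻¹' s ⊆ u ∪ v → (0 : ℂ) ∈ u →
      (fBasilica ⁻¹' s ∩ v).Nonempty → (fBasilica ⁻¹' s ∩ (u ∩ v)).Nonempty := by
    intro u v hu hv hsub h0 ⟨x, hxs, hxv⟩
    have hU : IsOpen (fBasilica '' (u ∩ Neg.neg ⁻¹' u)) :=
      fB_open _ (hu.inter (hu.preimage continuous_neg))
    have hV : IsOpen (fBasilica '' v) := fB_open _ hv
    have hcov : s ⊆ fBasilica '' (u ∩ Neg.neg ⁻¹' u) ∪ fBasilica '' v := by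
      intro w hw
      obtain ⟨y, hy⟩ : ∃ y, y ^ 2 = w + 1 := IsAlgClosed.exists_pow_nat_eq _ (by norm_num)
      have hyf : fBasilica y = w := by rw [fB_apply, hy]; ring
      rcases hsub (show y ∈ fBasilica ⁻¹' s by rw [Set.mem_preimage, hyf]; exact hw) with a | a
      · rcases hsub (show -y ∈ fBasilica ⁻¹' s by
          rw [Set.mem_preimage, fB_neg, hyf]; exact hw) with b | b
        · exact Or.inl ⟨y, ⟨a, b⟩, hyf⟩
        · exact Or.inr ⟨-y, b, by rw [fB_neg, hyf]⟩
      · exact Or.inr ⟨y, a, hyf⟩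
    obtain ⟨w, hws, ⟨y, ⟨hy1, hy2⟩, rfl⟩, ⟨y', hy', e⟩⟩ := hs _ _ hU hV hcov
      ⟨-1, h1, 0, ⟨h0, by simpa using h0⟩, by simp [fB_apply]⟩ ⟨fBasilica x, hxs, x, hxv, rfl⟩
    · refine ⟨y', by rw [Set.mem_preimage, e]; exact hws, ?_, hy'⟩
      rcases fB_eq_iff e with rfl | rfl
      · exact hy1
      · exact hy2
  intro u v hu hv hsub hnu hnv
  have h0 : (0 : ℂ) ∈ fBasilica ⁻¹' s := by simpa [fB_apply] using h1
  rcases hsub h0 with h | h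
  · exact main u v hu hv hsub h hnv
  · rw [Set.inter_comm u v]
    exact main v u hv hu (by rwa [Set.union_comm]) h hnu

lemma pre_KA {s : Set ℂ} (hs : s ⊆ KA) : fBasilica ⁻¹' s ⊆ KA := by
  intro z hz
  refine ⟨mem_K_f.1 (hs hz).1, ?_⟩
  rintro h
  rw [Set.mem_singleton_iff] at h
  subst h
  have := (hs hz).2
  rw [f_alpha] at this
  exact this rfl

lemma pre_L {z : ℂ} (h : fBasilica z ∈ leftB) : z ∈ rightBasilica :=
  sub_R (preimage_conn L_conn neg_one_L) (pre_KA L_KA) (x := 0)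
    (by simpa [fB_apply] using neg_one_L) zero_R h

/-- Principal branch of `√(1 + w)`. -/
noncomputable def sqB (w : ℂ) : ℂ := Complex.exp (Complex.log (1 + w) / 2)

lemma sqB_sq {w : ℂ} (h : w ≠ -1) : sqB w ^ 2 = 1 + w := by
  have h' : 1 + w ≠ 0 := fun e => h (by linear_combination e)
  unfold sqB
  rw [← Complex.exp_nat_mul]
  push_cast
  rw [mul_div_cancel₀ _ (by norm_num), Complex.exp_log h']

lemma f_sq {w : ℂ} (h : w ≠ -1) : fBasilica (sqB w) = w := by
  rw [fB_apply, sqB_sq h]; ring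

lemma f_eq_iff {z w : ℂ} (hw : w ≠ -1) : fBasilica z = w ↔ z = sqB w ∨ z = -sqB w := by
  constructor
  · intro h
    apply fB_eq_iff
    rw [f_sq hw, h]
  · rintro (rfl | rfl)
    · exact f_sq hw
    · rw [fB_neg, f_sq hw]

lemma R_ne {w : ℂ} (h : w ∈ rightBasilica) : w ≠ -1 := by
  rintro rfl; exact L_R_disj neg_one_L h

lemma slit_R {w : ℂ} (h : w ∈ rightBasilica) : 1 + w ∈ Complex.slitPlane := by
  left
  have := R_re h
  have := lt_aR
  simp; linarith

lemma sq_cont : ContinuousOn sqB rightBasilica := by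
  unfold sqB
  refine Complex.continuous_exp.comp_continuousOn (ContinuousOn.div_const ?_ _)
  exact ContinuousOn.clog (by fun_prop) fun w hw => slit_R hw

lemma sq_zero : sqB 0 = 1 := by simp [sqB]

lemma sq_R {w : ℂ} (h : w ∈ rightBasilica) : sqB w ∈ rightBasilica := by
  refine sub_R (R_conn.image _ sq_cont) ?_ (x := 1) ⟨0, zero_R, sq_zero⟩ one_R ⟨w, h, rfl⟩
  rintro _ ⟨w, h, rfl⟩
  exact pre_KA R_KA (show fBasilica (sqB w) ∈ _ by rwa [f_sq (R_ne h)])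

lemma neg_sq_R {w : ℂ} (h : w ∈ rightBasilica) : -sqB w ∈ leftB := by
  refine sub_L (R_conn.image _ sq_cont.neg) ?_ (x := -1) ⟨0, zero_R, by simp [sq_zero]⟩ neg_one_L
    ⟨w, h, rfl⟩
  rintro _ ⟨w, h, rfl⟩
  exact pre_KA R_KA (show fBasilica (-sqB w) ∈ _ by rwa [fB_neg, f_sq (R_ne h)])

lemma small_iter {w : ℂ} (hw : ‖w‖ < 1 / 3) (k : ℕ) :
    ‖fBasilica^[2 * k] w‖ ≤ (3 / 4) ^ k * (1 / 3) := by
  induction k with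
  | zero => simpa using hw.le
  | succ k ih =>
    rw [show 2 * (k + 1) = (2 * k + 1) + 1 by ring, Function.iterate_succ_apply',
      Function.iterate_succ_apply']
    set v := fBasilica^[2 * k] w
    have hv : ‖v‖ ≤ 1 / 3 := by
      have : (3 / 4 : ℝ) ^ k ≤ 1 := pow_le_one₀ (by norm_num) (by norm_num)
      linarith
    have e : fBasilica (fBasilica v) = v ^ 2 * (v ^ 2 - 2) := by simp only [fB_apply]; ring
    rw [e, norm_mul, norm_pow]
    have h1 : ‖v ^ 2 - 2‖ ≤ ‖v‖ ^ 2 + 2 := by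
      have := norm_sub_le (v ^ 2) 2
      simpa using this
    have h0 := norm_nonneg v
    calc ‖v‖ ^ 2 * ‖v ^ 2 - 2‖ ≤ ‖v‖ ^ 2 * (‖v‖ ^ 2 + 2) := by gcongr
      _ ≤ ‖v‖ * (3 / 4) := by
        have h2 : ‖v‖ * (‖v‖ ^ 2 + 2) ≤ 3 / 4 := by nlinarith
        nlinarith
      _ ≤ _ := by rw [pow_succ]; linarith

lemma small_tendsto {w : ℂ} (hw : ‖w‖ < 1 / 3) :
    Tendsto (fun k => fBasilica^[2 * k] w) atTop (𝓝 0) := by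
  apply squeeze_zero_norm (small_iter hw)
  have := (tendsto_pow_atTop_nhds_zero_of_lt_one (r := (3 / 4 : ℝ)) (by norm_num)
    (by norm_num)).mul_const (1 / 3)
  simpa using this

lemma mem_basin_def {z : ℂ} : z ∈ basilicaBasin ↔
    (Tendsto (fun n => fBasilica^[2 * n] z) atTop (𝓝 0) ∨
       Tendsto (fun n => fBasilica^[2 * n] z) atTop (𝓝 (-1))) := Iff.rfl

lemma basin_iff {z : ℂ} : z ∈ basilicaBasin ↔ ∃ m, ‖fBasilica^[m] z‖ < 1 / 3 := by
  have ev : ∀ u : ℕ → ℂ, Tendsto u atTop (𝓝 0) → ∃ n, ‖u n‖ < 1 / 3 := by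
    intro u hu
    have h := hu.norm
    rw [norm_zero] at h
    exact (h.eventually (gt_mem_nhds (by norm_num : (0 : ℝ) < 1 / 3))).exists
  rw [mem_basin_def]
  constructor
  · rintro (h | h)
    · obtain ⟨n, hn⟩ := ev _ h
      exact ⟨_, hn⟩
    · have h2 := (fB_cont.tendsto (-1)).comp h
      rw [show fBasilica (-1) = 0 by simp [fB_apply]] at h2
      obtain ⟨n, hn⟩ := ev _ h2
      refine ⟨2 * n + 1, ?_⟩
      rw [Function.iterate_succ_apply']; exact hn
  · rintro ⟨m, hm⟩
    have ht := small_tendsto hm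
    rcases Nat.even_or_odd' m with ⟨j, rfl | rfl⟩
    · left
      rw [← tendsto_add_atTop_iff_nat j]
      refine ht.congr fun n => ?_
      rw [← Function.iterate_add_apply]; congr 1; ring_nf
    · right
      rw [← tendsto_add_atTop_iff_nat (j + 1)]
      have h2 := (fB_cont.tendsto 0).comp ht
      rw [show fBasilica 0 = -1 by simp [fB_apply]] at h2
      refine h2.congr fun n => ?_
      simp only [Function.comp]
      rw [← Function.iterate_add_apply, ← Function.iterate_succ_apply' fBasilica]
      congr 1
      omega

lemma basin_open : IsOpen basilicaBasin := by
  have : basilicaBasin = ⋃ m, (fBasilica^[m]) ⁻¹' Metric.ball 0 (1 / 3) := by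
    ext z; simp [basin_iff]
  rw [this]
  exact isOpen_iUnion fun m => Metric.isOpen_ball.preimage (fB_iter_cont m)

lemma basin_f {z : ℂ} : fBasilica z ∈ basilicaBasin ↔ z ∈ basilicaBasin := by
  simp only [basin_iff]
  constructor
  · rintro ⟨m, hm⟩; exact ⟨m + 1, hm⟩
  · rintro ⟨m, hm⟩
    refine ⟨m + 1, ?_⟩
    rw [← Function.iterate_succ_apply, show (m + 1).succ = 2 * 1 + m by omega,
      Function.iterate_add_apply]
    have := small_iter hm 1
    linarith

lemma basin_K : basilicaBasin ⊆ filledJulia := by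
  intro z hz
  obtain ⟨m, hm⟩ := basin_iff.1 hz
  have h1 : fBasilica^[m] z ∈ filledJulia := by
    refine mem_K_def.2 (isBounded_iff_forall_norm_le.2 ⟨2, ?_⟩)
    rintro _ ⟨n, rfl⟩
    have hs : ∀ k, ‖fBasilica^[2 * k] (fBasilica^[m] z)‖ ≤ 1 / 3 := fun k => by
      have h1 := small_iter hm k
      have : (3 / 4 : ℝ) ^ k ≤ 1 := pow_le_one₀ (by norm_num) (by norm_num)
      linarith
    simp only
    rcases Nat.even_or_odd' n with ⟨j, rfl | rfl⟩
    · linarith [hs j]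
    · rw [Function.iterate_succ_apply', fB_apply]
      have h2 := hs j
      set v := fBasilica^[2 * j] (fBasilica^[m] z)
      have h3 : ‖v ^ 2 - 1‖ ≤ ‖v‖ ^ 2 + 1 := by
        have := norm_sub_le (v ^ 2) 1
        simpa using this
      nlinarith [norm_nonneg v]
  clear hm
  induction m with
  | zero => exact h1
  | succ m ih => rw [Function.iterate_succ_apply'] at h1; exact ih (mem_K_f.1 h1)

lemma basin_KA : basilicaBasin ⊆ KA := by
  intro z hz
  refine ⟨basin_K hz, ?_⟩
  intro h
  rw [Set.mem_singleton_iff] at h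
  subst h
  obtain ⟨m, hm⟩ := basin_iff.1 hz
  rw [Function.iterate_fixed f_alpha, alpha_eq, Complex.norm_real, Real.norm_eq_abs] at hm
  have := (abs_lt.1 hm).1
  have := aR_lt
  linarith

/-- The bubble of a point. -/
noncomputable def bub (z : ℂ) : Set ℂ := connectedComponentIn basilicaBasin z

lemma bub_conn (z : ℂ) : IsPreconnected (bub z) := isPreconnected_connectedComponentIn
lemma bub_basin (z : ℂ) : bub z ⊆ basilicaBasin := connectedComponentIn_subset _ _
lemma bub_KA (z : ℂ) : bub z ⊆ KA := (bub_basin z).trans basin_KA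
lemma mem_bub {z : ℂ} (hz : z ∈ basilicaBasin) : z ∈ bub z := mem_connectedComponentIn hz
lemma bub_open (z : ℂ) : IsOpen (bub z) := basin_open.connectedComponentIn
lemma bub_eq {z w : ℂ} (h : w ∈ bub z) : bub z = bub w := connectedComponentIn_eq h

lemma bub_maps {z w : ℂ} (hw : w ∈ bub z) : fBasilica w ∈ bub (fBasilica z) := by
  have hz : z ∈ basilicaBasin := connectedComponentIn_nonempty_iff.1 ⟨w, hw⟩
  refine ((bub_conn z).image _ fB_cont.continuousOn).subset_connectedComponentIn
    ⟨z, mem_bub hz, rfl⟩ ?_ ⟨w, hw, rfl⟩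
  rintro _ ⟨v, hv, rfl⟩
  exact basin_f.2 (bub_basin _ hv)

lemma bub_neg {z w : ℂ} (hw : w ∈ bub z) : -w ∈ bub (-z) := by
  have hz : z ∈ basilicaBasin := connectedComponentIn_nonempty_iff.1 ⟨w, hw⟩
  refine ((bub_conn z).image _ continuous_neg.continuousOn).subset_connectedComponentIn
    ⟨z, mem_bub hz, rfl⟩ ?_ ⟨w, hw, rfl⟩
  rintro _ ⟨v, hv, rfl⟩
  rw [← basin_f, fB_neg]
  exact basin_f.2 (bub_basin _ hv)

lemma bub_image {z : ℂ} (hz : z ∈ basilicaBasin) : fBasilica '' bub z = bub (fBasilica z) := by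
  apply Set.Subset.antisymm
  · rintro _ ⟨w, hw, rfl⟩; exact bub_maps hw
  -- the complement of the image inside the target bubble is open
  set N : Set ℂ := fBasilica '' (basilicaBasin \ (bub z ∪ Neg.neg ⁻¹' bub z)) with hN
  have hNo : IsOpen N := by
    apply fB_open
    have : basilicaBasin \ (bub z ∪ Neg.neg ⁻¹' bub z) =
        ⋃ w ∈ basilicaBasin \ (bub z ∪ Neg.neg ⁻¹' bub z), bub w := by
      ext v
      simp only [Set.mem_iUnion, exists_prop]
      constructor
      · intro hv; exact ⟨v, hv, mem_bub hv.1⟩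
      · rintro ⟨w, ⟨hw1, hw2⟩, hv⟩
        refine ⟨bub_basin _ hv, ?_⟩
        rintro (h | h)
        · apply hw2; left
          rw [bub_eq h, ← bub_eq hv]; exact mem_bub hw1
        · apply hw2; right
          have h' : -v ∈ bub z := h
          rw [Set.mem_preimage, bub_eq h']
          apply bub_neg
          rw [← bub_eq hv]; exact mem_bub hw1
    rw [this]
    exact isOpen_biUnion fun w _ => bub_open w
  have hIo : IsOpen (fBasilica '' bub z) := fB_open _ (bub_open z)
  by_contra hcon
  rw [Set.not_subset] at hcon
  have hcov : ∀ v ∈ bub (fBasilica z), v ∈ fBasilica '' bub z ∨ v ∈ N := by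
    intro v hv
    obtain ⟨y, hy⟩ : ∃ y, y ^ 2 = v + 1 := IsAlgClosed.exists_pow_nat_eq _ (by norm_num)
    have hyf : fBasilica y = v := by rw [fB_apply, hy]; ring
    have hyb : y ∈ basilicaBasin := basin_f.1 (by rw [hyf]; exact bub_basin _ hv)
    by_cases h1 : y ∈ bub z
    · exact Or.inl ⟨y, h1, hyf⟩
    by_cases h2 : -y ∈ bub z
    · exact Or.inl ⟨-y, h2, by rw [fB_neg, hyf]⟩
    exact Or.inr ⟨y, ⟨hyb, by rintro (h | h); exacts [h1 h, h2 h]⟩, hyf⟩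
  obtain ⟨v, hv, hv2⟩ := hcon
  obtain ⟨x, -, ⟨p, hp, e1⟩, ⟨q, hq, e2⟩⟩ := bub_conn (fBasilica z) _ _ hIo hNo hcov
    ⟨fBasilica z, mem_bub (basin_f.2 hz), z, mem_bub hz, rfl⟩
    ⟨v, hv, (hcov v hv).resolve_left hv2⟩
  apply hq.2
  rcases fB_eq_iff (e1.trans e2.symm) with rfl | rfl
  · exact Or.inl hp
  · exact Or.inr hp

lemma basin_iter {z : ℂ} (hz : z ∈ basilicaBasin) (n : ℕ) : fBasilica^[n] z ∈ basilicaBasin := by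
  induction n with
  | zero => exact hz
  | succ n ih => rw [Function.iterate_succ_apply']; exact basin_f.2 ih

lemma bub_image_iter {z : ℂ} (hz : z ∈ basilicaBasin) (n : ℕ) :
    fBasilica^[n] '' bub z = bub (fBasilica^[n] z) := by
  induction n with
  | zero => simp
  | succ n ih =>
    rw [Function.iterate_succ', Set.image_comp, ih, bub_image (basin_iter hz n)]; rfl

lemma bub_sub_R {z : ℂ} (hz : z ∈ rightBasilica) : bub z ⊆ rightBasilica := by
  intro w hw
  have hzb : z ∈ basilicaBasin := connectedComponentIn_nonempty_iff.1 ⟨w, hw⟩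
  exact sub_R (bub_conn z) (bub_KA z) (mem_bub hzb) hz hw

lemma bub_sub_L {z : ℂ} (hz : z ∈ leftB) : bub z ⊆ leftB := by
  intro w hw
  have hzb : z ∈ basilicaBasin := connectedComponentIn_nonempty_iff.1 ⟨w, hw⟩
  exact sub_L (bub_conn z) (bub_KA z) (mem_bub hzb) hz hw

/-- Centers of bubbles of generation `n`. -/
def ZZ (n : ℕ) : Set ℂ := {z | fBasilica^[n] z = 0 ∧ ∀ m < n, fBasilica^[m] z ≠ 0}

lemma ZZ_basin {n : ℕ} {z : ℂ} (h : z ∈ ZZ n) : z ∈ basilicaBasin :=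
  basin_iff.2 ⟨n, by rw [h.1]; norm_num⟩

lemma ZZ_zero {z : ℂ} : z ∈ ZZ 0 ↔ z = 0 := by
  constructor
  · intro h; exact h.1
  · rintro rfl; exact ⟨rfl, by simp⟩

lemma ZZ_succ {n : ℕ} {z : ℂ} : z ∈ ZZ (n + 1) ↔ fBasilica z ∈ ZZ n ∧ z ≠ 0 := by
  constructor
  · rintro ⟨h1, h2⟩
    refine ⟨⟨h1, fun m hm => h2 (m + 1) (by omega)⟩, h2 0 (by omega)⟩
  · rintro ⟨⟨h1, h2⟩, h3⟩
    refine ⟨h1, fun m hm => ?_⟩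
    cases m with
    | zero => exact h3
    | succ m => exact h2 m (by omega)

lemma R_cases {z : ℂ} (h : fBasilica z ∈ rightBasilica) :
    (z = sqB (fBasilica z) ∧ z ∈ rightBasilica) ∨ (z = -sqB (fBasilica z) ∧ z ∈ leftB) := by
  rcases (f_eq_iff (R_ne h)).1 rfl with e | e
  · left; refine ⟨e, ?_⟩; rw [e]; exact sq_R h
  · right; refine ⟨e, ?_⟩; rw [e]; exact neg_sq_R h

lemma ZZ_LR {n : ℕ} : ∀ {z : ℂ}, z ∈ ZZ n → z ∈ leftB ∨ z ∈ rightBasilica := by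
  induction n with
  | zero => intro z hz; rw [ZZ_zero.1 hz]; exact Or.inr zero_R
  | succ n ih =>
    intro z hz
    rcases ih (ZZ_succ.1 hz).1 with h | h
    · exact Or.inr (pre_L h)
    · rcases R_cases h with h | h
      · exact Or.inr h.2
      · exact Or.inl h.2

lemma L_f {n : ℕ} {z : ℂ} (hz : z ∈ ZZ (n + 1)) (hL : z ∈ leftB) :
    fBasilica z ∈ rightBasilica := by
  rcases ZZ_LR (ZZ_succ.1 hz).1 with h | h
  · exact (L_R_disj hL (pre_L h)).elim
  · exact h

lemma ZZ_one_L {z : ℂ} (hz : z ∈ ZZ 1) (hL : z ∈ leftB) : z = -1 := by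
  have h0 := ZZ_zero.1 (ZZ_succ.1 hz).1
  rcases R_cases (L_f hz hL) with h | h
  · exact (L_R_disj hL h.2).elim
  · rw [h.1, h0, sq_zero]

lemma zero_basin : (0 : ℂ) ∈ basilicaBasin := ZZ_basin (ZZ_zero.2 rfl)

lemma f_zero : fBasilica 0 = -1 := by simp [fB_apply]
lemma f_neg_one : fBasilica (-1) = 0 := by simp [fB_apply]

/-- The only center in `B₀` is `0`. -/
lemma bub_zero_center (n : ℕ) : ∀ z ∈ bub 0, z ∈ ZZ n → n = 0 := by
  induction n using Nat.strong_induction_on with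
  | _ n ih =>
    intro z hz hZ
    have h1 : fBasilica z ∈ bub (-1) := by rw [← f_zero]; exact bub_maps hz
    have h1L : fBasilica z ∈ leftB := bub_sub_L neg_one_L h1
    have h2 : fBasilica (fBasilica z) ∈ bub 0 := by
      have := bub_maps h1; rwa [f_neg_one] at this
    match n, ih, hZ with
    | 0, _, _ => rfl
    | 1, _, hZ =>
      have := ZZ_zero.1 (ZZ_succ.1 hZ).1
      rw [this] at h1L
      exact (L_R_disj h1L zero_R).elim
    | n + 2, ih, hZ =>
      have hZ1 := (ZZ_succ.1 hZ).1
      have hZ2 := (ZZ_succ.1 hZ1).1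
      have h0 := ih n (by omega) _ h2 hZ2
      subst h0
      have := ZZ_one_L hZ1 h1L
      exfalso
      apply (ZZ_succ.1 hZ).2
      rw [fB_apply] at this
      have h : z ^ 2 = 0 := by linear_combination this
      exact pow_eq_zero_iff (by norm_num) |>.1 h

/-- Continuous logarithms on bubbles. -/
lemma bub_log (n : ℕ) : ∀ z ∈ ZZ n,
    (z ∈ rightBasilica → 1 ≤ n → ∃ l : ℂ → ℂ, ContinuousOn l (bub z) ∧
      ∀ v ∈ bub z, Complex.exp (l v) = v) ∧
    (z ∈ leftB → 2 ≤ n → ∃ l : ℂ → ℂ, ContinuousOn l (bub z) ∧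
      ∀ v ∈ bub z, Complex.exp (l v) = 1 + v) := by
  induction n with
  | zero => intro z _; exact ⟨fun _ h => by omega, fun _ h => by omega⟩
  | succ n ih =>
    intro z hz
    have hz' := (ZZ_succ.1 hz).1
    have hmaps : Set.MapsTo fBasilica (bub z) (bub (fBasilica z)) := fun v hv => bub_maps hv
    constructor
    · intro hR _
      rcases ZZ_LR hz' with hL' | hR'
      · have hn : 2 ≤ n := by
          by_contra hn
          have : n = 0 ∨ n = 1 := by omega
          rcases this with rfl | rfl
          · rw [ZZ_zero.1 hz'] at hL'; exact L_R_disj hL' zero_R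
          · apply (ZZ_succ.1 hz).2
            have := ZZ_one_L hz' hL'
            rw [fB_apply] at this
            have h : z ^ 2 = 0 := by linear_combination this
            exact pow_eq_zero_iff (by norm_num) |>.1 h
        obtain ⟨l, hl, he⟩ := (ih _ hz').2 hL' hn
        have hc : ContinuousOn (fun v => l (fBasilica v) / 2) (bub z) :=
          (hl.comp fB_cont.continuousOn hmaps).div_const 2
        have hsq : ∀ v ∈ bub z, Complex.exp (l (fBasilica v) / 2) ^ 2 = v ^ 2 := by
          intro v hv
          rw [← Complex.exp_nat_mul]
          push_cast
          rw [mul_div_cancel₀ _ (by norm_num), he _ (hmaps hv), fB_apply]; ring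
        have := (bub_conn z).eq_or_eq_neg_of_sq_eq (f := fun v => v)
          (g := fun v => Complex.exp (l (fBasilica v) / 2)) continuousOn_id
          (Complex.continuous_exp.comp_continuousOn hc)
          (fun v hv => (hsq v hv).symm) (fun _ => Complex.exp_ne_zero _)
        rcases this with h | h
        · exact ⟨_, hc, fun v hv => (h hv).symm⟩
        · refine ⟨fun v => l (fBasilica v) / 2 + Real.pi * Complex.I, hc.add continuousOn_const, ?_⟩
          intro v hv
          have := h hv
          simp only [Pi.neg_apply] at this
          rw [Complex.exp_add, Complex.exp_pi_mul_I, mul_neg_one, ← this]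
      · have hfR : ∀ v ∈ bub z, fBasilica v ∈ rightBasilica := fun v hv =>
          bub_sub_R hR' (hmaps hv)
        refine ⟨fun v => Complex.log (1 + fBasilica v) / 2, ?_, ?_⟩
        · refine ContinuousOn.div_const (ContinuousOn.clog ?_ fun v hv => slit_R (hfR v hv)) _
          exact continuousOn_const.add fB_cont.continuousOn
        · intro v hv
          rcases R_cases (hfR v hv) with h | h
          · exact h.1.symm
          · exact (L_R_disj h.2 (bub_sub_R hR hv)).elim
    · intro hL hn
      obtain ⟨l, hl, he⟩ := (ih _ hz').1 (L_f hz hL) (by omega)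
      have hs : ∀ v ∈ bub z, 1 - v ∈ Complex.slitPlane := by
        intro v hv
        left
        have := L_re (bub_sub_L hL hv)
        have := aR_lt
        simp; linarith
      refine ⟨fun v => l (fBasilica v) + Real.pi * Complex.I - Complex.log (1 - v), ?_, ?_⟩
      · refine ((hl.comp fB_cont.continuousOn hmaps).add continuousOn_const).sub ?_
        exact ContinuousOn.clog (by fun_prop) hs
      · intro v hv
        have h1 := Complex.slitPlane_ne_zero (hs v hv)
        rw [Complex.exp_sub, Complex.exp_add, Complex.exp_pi_mul_I, he _ (hmaps hv),
          Complex.exp_log h1, div_eq_iff h1, fB_apply]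
        ring

lemma bub_not_symm {n : ℕ} {z : ℂ} (hz : z ∈ ZZ (n + 1)) (h : -z ∈ bub z) : False := by
  have hzb := ZZ_basin hz
  rcases ZZ_LR hz with hL | hR
  · have h1 := L_re hL
    have h2 := L_re (bub_sub_L hL h)
    have := aR_lt
    simp at h2
    linarith
  · obtain ⟨l, hl, he⟩ := (bub_log _ z hz).1 hR (by omega)
    have hneg : Set.MapsTo Neg.neg (bub z) (bub z) := by
      intro v hv
      rw [bub_eq h]; exact bub_neg hv
    have hc : ContinuousOn (fun v => Complex.exp (l v / 2)) (bub z) :=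
      Complex.continuous_exp.comp_continuousOn (hl.div_const 2)
    have hsq : ∀ v ∈ bub z, Complex.exp (l v / 2) ^ 2 = v := by
      intro v hv
      rw [← Complex.exp_nat_mul]
      push_cast
      rw [mul_div_cancel₀ _ (by norm_num), he _ hv]
    generalize hH : (fun v => Complex.exp (l v / 2)) = H at hc
    have hHsq : ∀ v ∈ bub z, H v ^ 2 = v := by rw [← hH]; exact hsq
    have hH0 : ∀ v, H v ≠ 0 := by rw [← hH]; exact fun v => Complex.exp_ne_zero _
    have := (bub_conn z).eq_or_eq_neg_of_sq_eq (f := fun v => H (-v))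
      (g := fun v => Complex.I * H v) (hc.comp continuous_neg.continuousOn hneg)
      (continuousOn_const.mul hc)
      (fun v hv => by
        simp only [Pi.pow_apply]
        rw [mul_pow, hHsq _ hv, hHsq _ (hneg hv), Complex.I_sq]; ring)
      (fun _ => mul_ne_zero Complex.I_ne_zero (hH0 _))
    have hzm := mem_bub hzb
    have hI := Complex.I_sq
    apply hH0 z
    rcases this with h' | h'
    · have e1 := h' hzm
      have e2 := h' h
      simp only [neg_neg] at e1 e2
      rw [e1] at e2
      linear_combination (1 / 2) * e2 + (1 / 2) * H z * hI
    · have e1 := h' hzm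
      have e2 := h' h
      simp only [neg_neg, Pi.neg_apply] at e1 e2
      rw [e1] at e2
      linear_combination (1 / 2) * e2 + (1 / 2) * H z * hI

lemma center_unique (n : ℕ) : ∀ z w, z ∈ ZZ n → w ∈ ZZ n → w ∈ bub z → w = z := by
  induction n with
  | zero => intro z w hz hw _; rw [ZZ_zero.1 hz, ZZ_zero.1 hw]
  | succ n ih =>
    intro z w hz hw h
    have := ih _ _ (ZZ_succ.1 hz).1 (ZZ_succ.1 hw).1 (bub_maps h)
    rcases fB_eq_iff this with h' | h'
    · exact h'
    · rw [h'] at h; exact (bub_not_symm hz h).elim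

lemma ZZ_iter {n m : ℕ} {z : ℂ} (hz : z ∈ ZZ (m + n)) : fBasilica^[m] z ∈ ZZ n := by
  refine ⟨?_, fun k hk => ?_⟩
  · rw [← Function.iterate_add_apply, Nat.add_comm]; exact hz.1
  · rw [← Function.iterate_add_apply]; exact hz.2 _ (by omega)

lemma B0_eq : B0 = bub 0 := rfl

lemma gen_of_center {n : ℕ} {z : ℂ} (hz : z ∈ ZZ n) : bubbleGen (bub z) = n := by
  have hzb := ZZ_basin hz
  unfold bubbleGen
  have hmem : n ∈ {n : ℕ | fBasilica^[n] '' bub z ⊆ B0} := by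
    show fBasilica^[n] '' bub z ⊆ B0
    rw [bub_image_iter hzb, hz.1, B0_eq]
  apply le_antisymm (Nat.sInf_le hmem)
  apply le_csInf ⟨n, hmem⟩
  intro m hm
  by_contra hlt
  push Not at hlt
  obtain ⟨k, rfl⟩ := Nat.exists_eq_add_of_lt hlt
  have h1 : fBasilica^[m] z ∈ bub 0 := hm ⟨z, mem_bub hzb, rfl⟩
  have := bub_zero_center (k + 1) _ h1 (ZZ_iter hz)
  omega

lemma center_of_gen {n : ℕ} (hn : 1 ≤ n) {F : Set ℂ} (hF : IsBubble F) (hg : bubbleGen F = n) :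
    ∃ z ∈ ZZ n, F = bub z := by
  obtain ⟨y, hy, rfl⟩ := hF
  change bubbleGen (bub y) = n at hg
  have hne : {n : ℕ | fBasilica^[n] '' bub y ⊆ B0}.Nonempty := by
    by_contra h
    rw [Set.not_nonempty_iff_eq_empty] at h
    unfold bubbleGen at hg
    rw [h, Nat.sInf_empty] at hg
    omega
  have hmem := Nat.sInf_mem hne
  change bubbleGen (bub y) ∈ _ at hmem
  rw [hg] at hmem
  have hmem' : fBasilica^[n] '' bub y ⊆ bub 0 := hmem
  have h0 : (0 : ℂ) ∈ fBasilica^[n] '' bub y := by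
    have h1 : fBasilica^[n] y ∈ bub 0 := hmem' ⟨y, mem_bub hy, rfl⟩
    rw [bub_image_iter hy, ← bub_eq h1]
    exact mem_bub zero_basin
  obtain ⟨z, hz, hz0⟩ := h0
  refine ⟨z, ⟨hz0, fun m hm hm0 => ?_⟩, bub_eq hz⟩
  have : m ∈ {n : ℕ | fBasilica^[n] '' bub y ⊆ B0} := by
    show fBasilica^[m] '' bub y ⊆ B0
    rw [bub_eq hz, bub_image_iter (bub_basin _ hz), hm0, B0_eq]
  have := Nat.sInf_le this
  change bubbleGen (bub y) ≤ m at this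
  omega

lemma card_eq_centers {n : ℕ} (hn : 1 ≤ n) :
    Set.ncard {F : Set ℂ | IsBubble F ∧ bubbleGen F = n ∧ F ⊆ rightBasilica} =
      (ZZ n ∩ rightBasilica).ncard := by
  have : {F : Set ℂ | IsBubble F ∧ bubbleGen F = n ∧ F ⊆ rightBasilica} =
      bub '' (ZZ n ∩ rightBasilica) := by
    apply Set.Subset.antisymm
    · rintro F ⟨h1, h2, h3⟩
      obtain ⟨z, hz, rfl⟩ := center_of_gen hn h1 h2
      exact ⟨z, ⟨hz, h3 (mem_bub (ZZ_basin hz))⟩, rfl⟩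
    · rintro _ ⟨z, ⟨hz, hR⟩, rfl⟩
      exact ⟨⟨z, ZZ_basin hz, rfl⟩, gen_of_center hz, bub_sub_R hR⟩
  rw [this]
  apply Set.ncard_image_of_injOn
  rintro z ⟨hz, -⟩ w ⟨hw, -⟩ e
  refine (center_unique n z w hz hw ?_).symm
  rw [e]; exact mem_bub (ZZ_basin hw)

lemma sqB_inj {z w : ℂ} (hz : z ≠ -1) (hw : w ≠ -1) (h : sqB z = sqB w) : z = w := by
  rw [← f_sq hz, h, f_sq hw]

lemma sqB_ne_zero (z : ℂ) : sqB z ≠ 0 := Complex.exp_ne_zero _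

lemma L_succ (n : ℕ) : ZZ (n + 1) ∩ leftB = (fun w => -sqB w) '' (ZZ n ∩ rightBasilica) := by
  ext z
  constructor
  · rintro ⟨hz, hL⟩
    have hR := L_f hz hL
    refine ⟨fBasilica z, ⟨(ZZ_succ.1 hz).1, hR⟩, ?_⟩
    rcases R_cases hR with h | h
    · exact (L_R_disj hL h.2).elim
    · exact h.1.symm
  · rintro ⟨w, ⟨hw, hR⟩, rfl⟩
    refine ⟨ZZ_succ.2 ⟨?_, neg_ne_zero.2 (sqB_ne_zero w)⟩, neg_sq_R hR⟩
    simp only [fB_neg, f_sq (R_ne hR)]; exact hw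

lemma neg_one_ZZ : (-1 : ℂ) ∈ ZZ 1 := ZZ_succ.2 ⟨by rw [f_neg_one]; exact ZZ_zero.2 rfl, by simp⟩

lemma ZZ_disj {n m : ℕ} {z : ℂ} (h1 : z ∈ ZZ n) (h2 : z ∈ ZZ m) : n = m := by
  rcases lt_trichotomy n m with h | h | h
  · exact (h2.2 n h h1.1).elim
  · exact h
  · exact (h1.2 m h h2.1).elim

lemma R_succ {n : ℕ} (hn : 2 ≤ n) : ZZ (n + 1) ∩ rightBasilica =
    sqB '' (ZZ n ∩ rightBasilica) ∪ (sqB '' (ZZ n ∩ leftB) ∪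
      (fun w => -sqB w) '' (ZZ n ∩ leftB)) := by
  have hne : ∀ {w}, w ∈ ZZ n → w ≠ -1 := by
    rintro w hw rfl
    have := ZZ_disj hw neg_one_ZZ
    omega
  ext z
  constructor
  · rintro ⟨hz, hR⟩
    have hz' := (ZZ_succ.1 hz).1
    rcases ZZ_LR hz' with h | h
    · right
      rcases (f_eq_iff (hne hz')).1 rfl with e | e
      · exact Or.inl ⟨_, ⟨hz', h⟩, e.symm⟩
      · exact Or.inr ⟨_, ⟨hz', h⟩, e.symm⟩
    · left
      rcases R_cases h with h' | h'
      · exact ⟨_, ⟨hz', h⟩, h'.1.symm⟩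
      · exact (L_R_disj h'.2 hR).elim
  · rintro (⟨w, ⟨hw, hR⟩, rfl⟩ | ⟨w, ⟨hw, hL⟩, rfl⟩ | ⟨w, ⟨hw, hL⟩, rfl⟩)
    · exact ⟨ZZ_succ.2 ⟨by rwa [f_sq (hne hw)], sqB_ne_zero w⟩, sq_R hR⟩
    · exact ⟨ZZ_succ.2 ⟨by rwa [f_sq (hne hw)], sqB_ne_zero w⟩, pre_L (by rwa [f_sq (hne hw)])⟩
    · exact ⟨ZZ_succ.2 ⟨by simpa only [fB_neg, f_sq (hne hw)] using hw,
        neg_ne_zero.2 (sqB_ne_zero w)⟩, pre_L (by simpa only [fB_neg, f_sq (hne hw)] using hL)⟩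

lemma R_one : ZZ 1 ∩ rightBasilica = {1} := by
  ext z
  constructor
  · rintro ⟨hz, hR⟩
    have h0 := ZZ_zero.1 (ZZ_succ.1 hz).1
    rcases R_cases (z := z) (by rw [h0]; exact zero_R) with h | h
    · rw [h.1, h0, sq_zero]; rfl
    · exact (L_R_disj h.2 hR).elim
  · rintro rfl
    exact ⟨ZZ_succ.2 ⟨ZZ_zero.2 (by simp [fB_apply]), by simp⟩, one_R⟩

lemma R_two : ZZ 2 ∩ rightBasilica = {sqB 1} := by
  ext z
  constructor
  · rintro ⟨hz, hR⟩
    have hz' := (ZZ_succ.1 hz).1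
    rcases ZZ_LR hz' with h | h
    · exfalso
      apply (ZZ_succ.1 hz).2
      have := ZZ_one_L hz' h
      rw [fB_apply] at this
      have h : z ^ 2 = 0 := by linear_combination this
      exact pow_eq_zero_iff (by norm_num) |>.1 h
    · have h1 : fBasilica z = 1 := by
        have : fBasilica z ∈ ZZ 1 ∩ rightBasilica := ⟨hz', h⟩
        rwa [R_one] at this
      rcases R_cases h with h' | h'
      · rw [h'.1, h1]; rfl
      · exact (L_R_disj h'.2 hR).elim
  · rintro rfl
    refine ⟨ZZ_succ.2 ⟨?_, sqB_ne_zero 1⟩, sq_R one_R⟩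
    rw [f_sq (R_ne one_R)]
    have : (1 : ℂ) ∈ ZZ 1 ∩ rightBasilica := by rw [R_one]; rfl
    exact this.1

lemma count (n : ℕ) : ((ZZ (n + 1) ∩ rightBasilica).Finite ∧
    (3 * (ZZ (n + 1) ∩ rightBasilica).ncard : ℤ) = 2 ^ (n + 1) - (-1) ^ (n + 1)) ∧
    ((ZZ (n + 2) ∩ rightBasilica).Finite ∧
    (3 * (ZZ (n + 2) ∩ rightBasilica).ncard : ℤ) = 2 ^ (n + 2) - (-1) ^ (n + 2)) := by
  induction n with
  | zero => simp only [Nat.zero_add, R_one, R_two]; norm_num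
  | succ n ih =>
    obtain ⟨⟨f1, c1⟩, ⟨f2, c2⟩⟩ := ih
    refine ⟨⟨f2, c2⟩, ?_⟩
    have hL := L_succ (n + 1)
    have hLf : (ZZ (n + 2) ∩ leftB).Finite := by rw [hL]; exact f1.image _
    have hLc : (ZZ (n + 2) ∩ leftB).ncard = (ZZ (n + 1) ∩ rightBasilica).ncard := by
      rw [hL]
      apply Set.ncard_image_of_injOn
      rintro z ⟨_, hz⟩ w ⟨_, hw⟩ e
      exact sqB_inj (R_ne hz) (R_ne hw) (neg_injective e)
    have hne : ∀ {w}, w ∈ ZZ (n + 2) → w ≠ -1 := by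
      rintro w hw rfl
      have := ZZ_disj hw neg_one_ZZ
      omega
    have hR := R_succ (n := n + 2) (by omega)
    have d1 : Disjoint (sqB '' (ZZ (n + 2) ∩ leftB)) ((fun w => -sqB w) '' (ZZ (n + 2) ∩ leftB)) := by
      rw [Set.disjoint_left]
      rintro _ ⟨w, ⟨hw, _⟩, rfl⟩ ⟨v, ⟨hv, _⟩, e⟩
      have e' : fBasilica (-sqB v) = fBasilica (sqB w) := congrArg _ e
      rw [fB_neg, f_sq (hne hv), f_sq (hne hw)] at e'
      subst e'
      simp only at e
      exact sqB_ne_zero v (by linear_combination (-1 / 2) * e)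
    have d2 : Disjoint (sqB '' (ZZ (n + 2) ∩ rightBasilica)) (sqB '' (ZZ (n + 2) ∩ leftB) ∪
        (fun w => -sqB w) '' (ZZ (n + 2) ∩ leftB)) := by
      rw [Set.disjoint_left]
      rintro _ ⟨w, ⟨hw, hwR⟩, rfl⟩ (⟨v, ⟨hv, hvL⟩, e⟩ | ⟨v, ⟨hv, hvL⟩, e⟩)
      · rw [sqB_inj (hne hv) (hne hw) e] at hvL
        exact L_R_disj hvL hwR
      · have e' : fBasilica (-sqB v) = fBasilica (sqB w) := congrArg _ e
        rw [fB_neg, f_sq (hne hv), f_sq (hne hw)] at e'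
        rw [e'] at hvL
        exact L_R_disj hvL hwR
    have k1 : (sqB '' (ZZ (n + 2) ∩ rightBasilica)).ncard = (ZZ (n + 2) ∩ rightBasilica).ncard := by
      apply Set.ncard_image_of_injOn
      rintro z ⟨hz, _⟩ w ⟨hw, _⟩ e
      exact sqB_inj (hne hz) (hne hw) e
    have k2 : (sqB '' (ZZ (n + 2) ∩ leftB)).ncard = (ZZ (n + 2) ∩ leftB).ncard := by
      apply Set.ncard_image_of_injOn
      rintro z ⟨hz, _⟩ w ⟨hw, _⟩ e
      exact sqB_inj (hne hz) (hne hw) e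
    have k3 : ((fun w => -sqB w) '' (ZZ (n + 2) ∩ leftB)).ncard = (ZZ (n + 2) ∩ leftB).ncard := by
      apply Set.ncard_image_of_injOn
      rintro z ⟨hz, _⟩ w ⟨hw, _⟩ e
      exact sqB_inj (hne hz) (hne hw) (neg_injective e)
    have g1 := f2.image sqB
    have g2 := hLf.image sqB
    have g3 := hLf.image (fun w => -sqB w)
    change (ZZ (n + 2 + 1) ∩ rightBasilica).Finite ∧
      (3 * (ZZ (n + 2 + 1) ∩ rightBasilica).ncard : ℤ) = _
    rw [hR]
    refine ⟨g1.union (g2.union g3), ?_⟩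
    rw [Set.ncard_union_eq d2 g1 (g2.union g3), Set.ncard_union_eq d1 g2 g3, k1, k2, k3, hLc]
    push_cast
    have p1 : (2 : ℤ) ^ (n + 1 + 2) = 4 * 2 ^ (n + 1) := by ring
    have p2 : (2 : ℤ) ^ (n + 2) = 2 * 2 ^ (n + 1) := by ring
    have p3 : (-1 : ℤ) ^ (n + 1 + 2) = (-1) ^ (n + 1) := by ring
    have p4 : (-1 : ℤ) ^ (n + 2) = - (-1) ^ (n + 1) := by ring
    rw [p2, p4] at c2
    rw [p1, p3]
    linarith

/-- For every `n ≥ 2`, the number of bubbles of generation `n` contained in the right half of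
the basilica equals the degree of `ξ_n`, namely `(2^n − (−1)^n)/3`. -/
theorem card_bubbles_in_right_basilica (n : ℕ) (hn : 2 ≤ n) :
    Set.ncard {F : Set ℂ | IsBubble F ∧ bubbleGen F = n ∧ F ⊆ rightBasilica}
      = ratDegree (xiFun n) ∧
    (ratDegree (xiFun n) : ℤ) = (2 ^ n - (-1) ^ n) / 3 := by
  have h1 := ratDegree_xi n (by omega)
  obtain ⟨m, rfl⟩ : ∃ m, n = m + 1 := ⟨n - 1, by omega⟩
  have h2 := (count m).1.2
  rw [card_eq_centers (by omega)]
  constructor <;> omega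
end

section
/- Let O = {A_1, …, A_p} be a formal orbit portrait whose angles all have the same exact period rp under the doubling map, and let v be its valence. Then either v = r, or v = 2 and r = 1. -/
open MeasureTheory

instance : Fact ((0 : ℝ) < 1) := ⟨zero_lt_one⟩

/-- The doubling map `θ ↦ 2θ (mod 1)` on the circle `ℝ/ℤ`. -/
noncomputable def dbl : AddCircle (1 : ℝ) → AddCircle (1 : ℝ) := fun θ => θ + θ

/-- The embedding `θ ↦ e^{2πiθ}` of `ℝ/ℤ` into `ℂ`. -/
noncomputable def circleEmbed : AddCircle (1 : ℝ) → ℂ := fun θ => (AddCircle.toCircle θ : ℂ)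

/-- A formal orbit portrait `{A_1, …, A_p}` (indices mod `p`): nonempty finite sets of angles,
carried bijectively onto each other by the doubling map preserving cyclic order, with all
angles of the same exact period `r·p` under doubling, and with pairwise disjoint convex hulls
of the corresponding sets of points of the unit circle in `ℂ`. -/
structure FormalOrbitPortrait (p r : ℕ) where
  hp : 0 < p
  hr : 1 ≤ r
  A : ZMod p → Set (AddCircle (1 : ℝ))
  nonempty : ∀ j, (A j).Nonempty
  finite : ∀ j, (A j).Finite
  bijOn : ∀ j, Set.BijOn dbl (A j) (A (j + 1))
  cyclicOrder : ∀ j, ∀ x ∈ A j, ∀ y ∈ A j, ∀ z ∈ A j,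
    sbtw x y z → sbtw (dbl x) (dbl y) (dbl z)
  period : ∀ j, ∀ θ ∈ A j, Function.minimalPeriod dbl θ = r * p
  hullDisjoint : ∀ i j : ZMod p, i ≠ j →
    Disjoint (convexHull ℝ (circleEmbed '' A i)) (convexHull ℝ (circleEmbed '' A j))


/-- Length in `[0,1)` of the positively oriented arc from `x` to `y`. -/
noncomputable def arcLen (x y : AddCircle (1 : ℝ)) : ℝ := (AddCircle.equivIco 1 0 (y - x) : ℝ)

lemma arcLen_nonneg (x y : AddCircle (1 : ℝ)) : 0 ≤ arcLen x y :=
  (AddCircle.equivIco 1 0 (y - x)).2.1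

lemma arcLen_lt_one (x y : AddCircle (1 : ℝ)) : arcLen x y < 1 := by
  have := (AddCircle.equivIco 1 0 (y - x)).2.2
  simpa [arcLen] using this

lemma coe_arcLen (x y : AddCircle (1 : ℝ)) : ((arcLen x y : ℝ) : AddCircle (1 : ℝ)) = y - x :=
  AddCircle.coe_equivIco

lemma int_of_coe_zero {a : ℝ} (h : ((a : ℝ) : AddCircle (1 : ℝ)) = 0) : ∃ n : ℤ, a = n := by
  obtain ⟨n, hn⟩ := (AddCircle.coe_eq_zero_iff (p := (1 : ℝ))).1 h
  exact ⟨n, by simpa using hn.symm⟩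

lemma arcLen_self (x : AddCircle (1 : ℝ)) : arcLen x x = 0 := by
  have h := coe_arcLen x x
  rw [sub_self] at h
  obtain ⟨n, hn⟩ := int_of_coe_zero h
  have h0 := arcLen_nonneg x x
  have h1 := arcLen_lt_one x x
  rw [hn] at h0 h1 ⊢
  have : n = 0 := by
    have a : (-1 : ℤ) < n := by exact_mod_cast (by linarith : (-1 : ℝ) < n)
    have b : n < 1 := by exact_mod_cast h1
    omega
  simp [this]

lemma arcLen_inj {x y z : AddCircle (1 : ℝ)} (h : arcLen x y = arcLen x z) : y = z := by
  have h1 := coe_arcLen x y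
  rw [h, coe_arcLen x z] at h1
  exact (sub_left_inj.1 h1).symm

lemma arcLen_pos {x y : AddCircle (1 : ℝ)} (h : x ≠ y) : 0 < arcLen x y := by
  rcases (arcLen_nonneg x y).lt_or_eq with h1 | h1
  · exact h1
  · exfalso
    apply h
    apply arcLen_inj (x := x)
    rw [arcLen_self, h1]

/-- Chasles relation. -/
lemma arcLen_tri (x y z : AddCircle (1 : ℝ)) :
    (arcLen x y ≤ arcLen x z ∧ arcLen y z = arcLen x z - arcLen x y) ∨
    (arcLen x z < arcLen x y ∧ arcLen y z = arcLen x z - arcLen x y + 1) := by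
  have h : ((arcLen y z - (arcLen x z - arcLen x y) : ℝ) : AddCircle (1 : ℝ)) = 0 := by
    rw [AddCircle.coe_sub, AddCircle.coe_sub, coe_arcLen, coe_arcLen, coe_arcLen]
    abel
  obtain ⟨n, hn⟩ := int_of_coe_zero h
  have a0 := arcLen_nonneg x y
  have a1 := arcLen_lt_one x y
  have b0 := arcLen_nonneg x z
  have b1 := arcLen_lt_one x z
  have c0 := arcLen_nonneg y z
  have c1 := arcLen_lt_one y z
  have a : (-1 : ℤ) < n := by exact_mod_cast (by linarith : (-1 : ℝ) < n)
  have b : n < 2 := by exact_mod_cast (by linarith : (n : ℝ) < 2)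
  have : n = 0 ∨ n = 1 := by omega
  rcases this with rfl | rfl
  · left
    norm_num at hn
    constructor <;> linarith
  · right
    norm_num at hn
    constructor <;> linarith

lemma arcLen_dbl (x y : AddCircle (1 : ℝ)) :
    (arcLen x y < 1 / 2 ∧ arcLen (dbl x) (dbl y) = 2 * arcLen x y) ∨
    (1 / 2 ≤ arcLen x y ∧ arcLen (dbl x) (dbl y) = 2 * arcLen x y - 1) := by
  have h : ((arcLen (dbl x) (dbl y) - (arcLen x y + arcLen x y) : ℝ) : AddCircle (1 : ℝ)) = 0 := by
    rw [AddCircle.coe_sub, AddCircle.coe_add, coe_arcLen, coe_arcLen]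
    simp only [dbl]
    abel
  obtain ⟨n, hn⟩ := int_of_coe_zero h
  have a0 := arcLen_nonneg x y
  have a1 := arcLen_lt_one x y
  have c0 := arcLen_nonneg (dbl x) (dbl y)
  have c1 := arcLen_lt_one (dbl x) (dbl y)
  have a : (-2 : ℤ) < n := by exact_mod_cast (by linarith : (-2 : ℝ) < n)
  have b : n < 1 := by exact_mod_cast (by linarith : (n : ℝ) < 1)
  have : n = 0 ∨ n = -1 := by omega
  rcases this with rfl | rfl
  · left
    norm_num at hn
    constructor <;> linarith
  · right
    norm_num at hn
    constructor <;> linarith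

lemma btw_iff_arcLen {x y z : AddCircle (1 : ℝ)} (h : z ≠ x) :
    btw x y z ↔ arcLen x y ≤ arcLen x z := by
  induction x using QuotientAddGroup.induction_on with | _ x
  induction y using QuotientAddGroup.induction_on with | _ y
  induction z using QuotientAddGroup.induction_on with | _ z
  have e : toIcoMod (zero_lt_one : (0 : ℝ) < 1) 0 (z - x) = toIocMod zero_lt_one 0 (z - x) := by
    rw [← AddCommGroup.not_modEq_iff_toIcoMod_eq_toIocMod]
    intro h'
    apply h
    rw [← sub_eq_zero]
    obtain ⟨n, hn⟩ := AddCommGroup.modEq_iff_zsmul'.1 h'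
    exact (AddCircle.coe_eq_zero_iff (p := (1 : ℝ))).2 ⟨n, by simpa using hn.symm⟩
  refine (QuotientAddGroup.btw_coe_iff' (p := (1 : ℝ))).trans ?_
  rw [← e]
  exact Iff.rfl

lemma sbtw_of_arcLen {x y z : AddCircle (1 : ℝ)} (h : y ≠ x) (h' : arcLen x y < arcLen x z) :
    sbtw x y z := by
  rw [sbtw_iff_not_btw, btw_cyclic, btw_iff_arcLen h]
  exact not_le.2 h'

lemma arcLen_of_sbtw {x y z : AddCircle (1 : ℝ)} (h : z ≠ x) (h' : sbtw x y z) :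
    arcLen x y ≤ arcLen x z := (btw_iff_arcLen h).1 h'.btw

lemma circleEmbed_add_coe (a b : ℝ) :
    circleEmbed ((a + b : ℝ) : AddCircle (1 : ℝ)) =
      ⟨Real.cos (2 * Real.pi * (a + b)), Real.sin (2 * Real.pi * (a + b))⟩ := by
  unfold circleEmbed
  rw [AddCircle.toCircle_apply_mk, Circle.coe_exp]
  apply Complex.ext
  · rw [Complex.exp_ofReal_mul_I_re]; simp
  · rw [Complex.exp_ofReal_mul_I_im]; simp

lemma area_eq (α β γ : ℝ) :
    (Real.cos (2*β) - Real.cos (2*α)) * (Real.sin (2*γ) - Real.sin (2*α)) -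
    (Real.sin (2*β) - Real.sin (2*α)) * (Real.cos (2*γ) - Real.cos (2*α)) =
    4 * Real.sin (β - α) * Real.sin (γ - β) * Real.sin (γ - α) := by
  rw [Real.cos_sub_cos, Real.cos_sub_cos, Real.sin_sub_sin, Real.sin_sub_sin]
  have e : Real.sin (γ - β) = Real.sin ((γ + α) - (β + α)) := by ring_nf
  rw [e, Real.sin_sub (γ + α) (β + α)]
  rw [show (2*β + 2*α)/2 = β + α by ring, show (2*β - 2*α)/2 = β - α by ring,
    show (2*γ + 2*α)/2 = γ + α by ring, show (2*γ - 2*α)/2 = γ - α by ring]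
  ring

lemma area_pos {α β γ : ℝ} (h1 : α < β) (h2 : β < γ) (h3 : γ < α + 1) :
    0 < (Real.cos (2*Real.pi*β) - Real.cos (2*Real.pi*α)) *
        (Real.sin (2*Real.pi*γ) - Real.sin (2*Real.pi*α)) -
    (Real.sin (2*Real.pi*β) - Real.sin (2*Real.pi*α)) *
    (Real.cos (2*Real.pi*γ) - Real.cos (2*Real.pi*α)) := by
  have := area_eq (Real.pi*α) (Real.pi*β) (Real.pi*γ)
  simp only [← mul_assoc] at this
  rw [this]
  have key : ∀ s t : ℝ, s < t → t < s + 1 → 0 < Real.sin (Real.pi * t - Real.pi * s) := by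
    intro s t h h'
    apply Real.sin_pos_of_pos_of_lt_pi
    · nlinarith [Real.pi_pos]
    · nlinarith [Real.pi_pos]
  have k1 := key α β h1 (by linarith)
  have k2 := key β γ h2 (by linarith)
  have k3 := key α γ (by linarith) (by linarith)
  positivity

lemma hull_two {S : Set ℂ} {P Q : ℂ} (hP : P ∈ S) (hQ : Q ∈ S) {a b : ℝ} (ha : 0 ≤ a)
    (hb : 0 ≤ b) (hab : a + b = 1) : a • P + b • Q ∈ convexHull ℝ S :=
  (convex_convexHull ℝ S) (subset_convexHull ℝ S hP) (subset_convexHull ℝ S hQ) ha hb hab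

/-- Linked pairs of points of the circle have intersecting hulls. -/
lemma crossing {A B : Set (AddCircle (1 : ℝ))}
    (hd : Disjoint (convexHull ℝ (circleEmbed '' A)) (convexHull ℝ (circleEmbed '' B)))
    {x z a b : AddCircle (1 : ℝ)} (hx : x ∈ A) (hz : z ∈ A) (ha : a ∈ B) (hb : b ∈ B)
    (h1 : 0 < arcLen x a) (h2 : arcLen x a < arcLen x z) (h3 : arcLen x z < arcLen x b) :
    False := by
  obtain ⟨X, rfl⟩ : ∃ X : ℝ, (X : AddCircle (1 : ℝ)) = x := QuotientAddGroup.mk_surjective x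
  have lift : ∀ y : AddCircle (1 : ℝ), circleEmbed y =
      ⟨Real.cos (2 * Real.pi * (X + arcLen X y)), Real.sin (2 * Real.pi * (X + arcLen X y))⟩ := by
    intro y
    rw [← circleEmbed_add_coe]
    congr 1
    rw [AddCircle.coe_add, coe_arcLen]
    abel
  have l0 := lift X
  rw [arcLen_self] at l0
  have l1 := lift a
  have l2 := lift z
  have l3 := lift b
  have h4 := arcLen_lt_one X b
  have D123 := area_pos (α := X + arcLen X a) (β := X + arcLen X z) (γ := X + arcLen X b)
    (by linarith) (by linarith) (by linarith)
  have D023 := area_pos (α := X + 0) (β := X + arcLen X z) (γ := X + arcLen X b)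
    (by linarith) (by linarith) (by linarith)
  have D013 := area_pos (α := X + 0) (β := X + arcLen X a) (γ := X + arcLen X b)
    (by linarith) (by linarith) (by linarith)
  have D012 := area_pos (α := X + 0) (β := X + arcLen X a) (γ := X + arcLen X z)
    (by linarith) (by linarith) (by linarith)
  generalize Real.cos (2 * Real.pi * (X + 0)) = c0 at *
  generalize Real.sin (2 * Real.pi * (X + 0)) = s0 at *
  generalize Real.cos (2 * Real.pi * (X + arcLen X a)) = c1 at *
  generalize Real.sin (2 * Real.pi * (X + arcLen X a)) = s1 at *
  generalize Real.cos (2 * Real.pi * (X + arcLen X z)) = c2 at *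
  generalize Real.sin (2 * Real.pi * (X + arcLen X z)) = s2 at *
  generalize Real.cos (2 * Real.pi * (X + arcLen X b)) = c3 at *
  generalize Real.sin (2 * Real.pi * (X + arcLen X b)) = s3 at *
  obtain ⟨u, hu⟩ : ∃ u, u = (c2 - c1) * (s3 - s1) - (s2 - s1) * (c3 - c1) := ⟨_, rfl⟩
  obtain ⟨w, hw⟩ : ∃ w, w = (c1 - c0) * (s3 - s0) - (s1 - s0) * (c3 - c0) := ⟨_, rfl⟩
  obtain ⟨u', hu'⟩ : ∃ u, u = (c2 - c0) * (s3 - s0) - (s2 - s0) * (c3 - c0) := ⟨_, rfl⟩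
  obtain ⟨w', hw'⟩ : ∃ w, w = (c1 - c0) * (s2 - s0) - (s1 - s0) * (c2 - c0) := ⟨_, rfl⟩
  rw [← hu] at D123
  rw [← hw] at D013
  rw [← hu'] at D023
  rw [← hw'] at D012
  have hs : u + w = u' + w' := by rw [hu, hw, hu', hw']; ring
  have p1 := hull_two (Set.mem_image_of_mem circleEmbed hx) (Set.mem_image_of_mem circleEmbed hz)
    (a := u / (u + w)) (b := w / (u + w)) (by positivity) (by positivity) (by field_simp)
  have p2 := hull_two (Set.mem_image_of_mem circleEmbed ha) (Set.mem_image_of_mem circleEmbed hb)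
    (a := u' / (u + w)) (b := w' / (u + w)) (by positivity) (by positivity)
    (by rw [hs]; field_simp)
  refine Set.disjoint_left.1 hd p1 ?_
  convert p2 using 1
  rw [l0, l1, l2, l3]
  have hne : u + w ≠ 0 := by positivity
  apply Complex.ext
  · simp only [Complex.add_re, Complex.smul_re, smul_eq_mul]
    field_simp
    rw [hu, hw, hu', hw']; ring
  · simp only [Complex.add_im, Complex.smul_im, smul_eq_mul]
    field_simp
    rw [hu, hw, hu', hw']; ring

/-- `(x, y)` are the endpoints of a complementary arc of `A`. -/
def IsGap (A : Set (AddCircle (1 : ℝ))) (x y : AddCircle (1 : ℝ)) : Prop :=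
  x ∈ A ∧ y ∈ A ∧ x ≠ y ∧ ∀ z ∈ A, z ≠ x → arcLen x y ≤ arcLen x z

lemma IsGap.unique {A : Set (AddCircle (1 : ℝ))} {x y y' : AddCircle (1 : ℝ)}
    (h : IsGap A x y) (h' : IsGap A x y') : y = y' :=
  arcLen_inj (le_antisymm (h.2.2.2 _ h'.2.1 h'.2.2.1.symm) (h'.2.2.2 _ h.2.1 h.2.2.1.symm))

lemma exists_isGap {A : Set (AddCircle (1 : ℝ))} (hf : A.Finite) (hn : A.Nontrivial)
    {x : AddCircle (1 : ℝ)} (hx : x ∈ A) : ∃ y, IsGap A x y := by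
  obtain ⟨y0, hy0, hne⟩ := hn.exists_ne x
  obtain ⟨y, hy, hmin⟩ := Set.exists_min_image (A \ {x}) (arcLen x) hf.sdiff ⟨y0, hy0, hne⟩
  exact ⟨y, hx, hy.1, fun h => hy.2 h.symm, fun z hz hzx => hmin z ⟨hz, hzx⟩⟩

/-- A set has at most one long gap. -/
lemma IsGap.crit_unique {A : Set (AddCircle (1 : ℝ))} {x y x' y' : AddCircle (1 : ℝ)}
    (h : IsGap A x y) (h' : IsGap A x' y') (hl : 1 / 2 < arcLen x y) (hl' : 1 / 2 < arcLen x' y') :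
    x = x' := by
  by_contra hne
  have h1 := h.2.2.2 x' h'.1 (Ne.symm hne)
  have h2 := h'.2.2.2 x h.1 hne
  have h3 := arcLen_tri x x' x
  rw [arcLen_self] at h3
  rcases h3 with h3 | h3 <;> linarith

section portrait
variable {p r : ℕ} (O : FormalOrbitPortrait p r)

lemma portrait_disjoint {i j : ZMod p} (h : i ≠ j) {x y : AddCircle (1 : ℝ)} (hx : x ∈ O.A i)
    (hy : y ∈ O.A j) : x ≠ y := by
  rintro rfl
  exact Set.disjoint_left.1 (O.hullDisjoint i j h)
    (subset_convexHull ℝ _ (Set.mem_image_of_mem circleEmbed hx))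
    (subset_convexHull ℝ _ (Set.mem_image_of_mem circleEmbed hy))

lemma portrait_iter (m : ℕ) {i : ZMod p} {x : AddCircle (1 : ℝ)} (hx : x ∈ O.A i) :
    dbl^[m] x ∈ O.A (i + m) := by
  induction m with
  | zero => simpa using hx
  | succ m ih =>
    rw [Function.iterate_succ_apply']
    have := (O.bijOn _).mapsTo ih
    convert this using 2
    push_cast
    ring

lemma gap_ne_half {j : ZMod p} {x y : AddCircle (1 : ℝ)} (h : IsGap (O.A j) x y) :
    arcLen x y ≠ 1 / 2 := by
  intro he
  rcases arcLen_dbl x y with h1 | h1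
  · linarith
  · have h2 : arcLen (dbl x) (dbl y) = 0 := by linarith
    have h3 : dbl x ≠ dbl y := fun h' => h.2.2.1 ((O.bijOn j).injOn h.1 h.2.1 h')
    have := arcLen_pos h3
    linarith

lemma gap_dbl {j : ZMod p} {x y : AddCircle (1 : ℝ)} (h : IsGap (O.A j) x y) :
    IsGap (O.A (j + 1)) (dbl x) (dbl y) := by
  obtain ⟨hx, hy, hxy, hmin⟩ := h
  refine ⟨(O.bijOn j).mapsTo hx, (O.bijOn j).mapsTo hy,
    fun h' => hxy ((O.bijOn j).injOn hx hy h'), ?_⟩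
  intro z' hz' hne
  obtain ⟨z, hz, rfl⟩ := (O.bijOn j).surjOn hz'
  have hzx : z ≠ x := fun h => hne (by rw [h])
  by_cases hzy : z = y
  · rw [hzy]
  have hlt : arcLen x y < arcLen x z :=
    lt_of_le_of_ne (hmin z hz hzx) (fun h => hzy (arcLen_inj h).symm)
  exact arcLen_of_sbtw hne (O.cyclicOrder j x hx y hy z hz (sbtw_of_arcLen hxy.symm hlt))

lemma gap_pred (hn : ∀ j, (O.A j).Nontrivial) {j : ZMod p} {x y : AddCircle (1 : ℝ)}
    (h : IsGap (O.A (j + 1)) x y) : ∃ x0 y0, IsGap (O.A j) x0 y0 ∧ dbl x0 = x ∧ dbl y0 = y := by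
  obtain ⟨x0, hx0, rfl⟩ := (O.bijOn j).surjOn h.1
  obtain ⟨y0, hy0⟩ := exists_isGap (O.finite j) (hn j) hx0
  exact ⟨x0, y0, hy0, rfl, (gap_dbl O hy0).unique h⟩

/-- Every gap is the image, under repeated doubling, of a critical value gap. -/
lemma gap_back (hn : ∀ j, (O.A j).Nontrivial) {ε : ℝ}
    (hε : ∀ j x y, IsGap (O.A j) x y → ε ≤ arcLen x y) (n : ℕ) :
    ∀ (j : ZMod p) (x y : AddCircle (1 : ℝ)), IsGap (O.A j) x y → arcLen x y < 2 ^ n * ε →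
    ∃ (m : ℕ) (i : ZMod p) (z w : AddCircle (1 : ℝ)), IsGap (O.A i) z w ∧ 1 / 2 < arcLen z w ∧
      x = dbl^[m] (dbl z) ∧ 2 * arcLen z w - 1 ≤ arcLen x y := by
  induction n with
  | zero =>
    intro j x y h hl
    have := hε j x y h
    simp at hl
    linarith
  | succ n ih =>
    intro j x y h hl
    have hj : j = (j - 1) + 1 := by ring
    rw [hj] at h
    obtain ⟨x0, y0, h0, rfl, rfl⟩ := gap_pred O hn h
    rcases arcLen_dbl x0 y0 with h1 | h1
    · have hl' : arcLen x0 y0 < 2 ^ n * ε := by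
        rw [pow_succ] at hl
        linarith
      obtain ⟨m, i, z, w, hzw, hc, hx, hle⟩ := ih _ x0 y0 h0 hl'
      refine ⟨m + 1, i, z, w, hzw, hc, ?_, ?_⟩
      · rw [Function.iterate_succ_apply', ← hx]
      · have := arcLen_nonneg x0 y0
        linarith
    · refine ⟨0, j - 1, x0, y0, h0, lt_of_le_of_ne h1.1 (gap_ne_half O h0).symm, rfl, h1.2.ge⟩

lemma exists_min_gap (hn : ∀ j, (O.A j).Nontrivial) : ∃ j t t', IsGap (O.A j) t t' ∧
    ∀ i x y, IsGap (O.A i) x y → arcLen t t' ≤ arcLen x y := by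
  have : NeZero p := ⟨O.hp.ne'⟩
  have hU : (⋃ j, O.A j).Finite := Set.finite_iUnion O.finite
  have hS : {q : AddCircle (1 : ℝ) × AddCircle (1 : ℝ) | ∃ j, IsGap (O.A j) q.1 q.2}.Finite := by
    refine (hU.prod hU).subset ?_
    rintro ⟨a, b⟩ ⟨j, h⟩
    exact ⟨Set.mem_iUnion.2 ⟨j, h.1⟩, Set.mem_iUnion.2 ⟨j, h.2.1⟩⟩
  obtain ⟨x, hx⟩ := O.nonempty 0
  obtain ⟨y, hy⟩ := exists_isGap (O.finite 0) (hn 0) hx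
  obtain ⟨⟨t, t'⟩, ⟨j, h⟩, hmin⟩ := Set.exists_min_image _ (fun q => arcLen q.1 q.2) hS
    ⟨(x, y), 0, hy⟩
  exact ⟨j, t, t', h, fun i x y hxy => hmin (x, y) ⟨i, hxy⟩⟩

/-- Key step: apart from the start of the longest gap, every angle is in the forward orbit of
the start of the shortest gap. -/
lemma key_step (hn : ∀ j, (O.A j).Nontrivial) {k : ZMod p} {t t' : AddCircle (1 : ℝ)}
    (ht : IsGap (O.A (k + 1)) t t')
    (hmin : ∀ i x y, IsGap (O.A i) x y → arcLen t t' ≤ arcLen x y)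
    {x x' y y' : AddCircle (1 : ℝ)} (hx : IsGap (O.A (k + 1)) x x')
    (hy : IsGap (O.A (k + 1)) y y') (hxy : x ≠ y) (hle : arcLen x x' ≤ arcLen y y') :
    ∃ m, x = dbl^[m] t := by
  have tpos : 0 < arcLen t t' := arcLen_pos ht.2.2.1
  obtain ⟨t0, t0', ht0, rfl, rfl⟩ := gap_pred O hn ht
  have hl0 : 1 / 2 < arcLen t0 t0' ∧
      arcLen (dbl t0) (dbl t0') = 2 * arcLen t0 t0' - 1 := by
    rcases arcLen_dbl t0 t0' with h1 | h1
    · have := hmin _ _ _ ht0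
      linarith
    · exact ⟨lt_of_le_of_ne h1.1 (gap_ne_half O ht0).symm, h1.2⟩
  obtain ⟨n, hnlt⟩ := pow_unbounded_of_one_lt
    (arcLen x x' / arcLen (dbl t0) (dbl t0')) (one_lt_two : (1 : ℝ) < 2)
  rw [div_lt_iff₀ tpos] at hnlt
  obtain ⟨m, i, z, w, hzw, hc, hxz, hlen⟩ := gap_back O hn hmin n _ x x' hx hnlt
  by_cases hik : i = k
  · subst hik
    have := hzw.crit_unique ht0 hc hl0.1
    exact ⟨m, by rw [hxz, this]⟩
  exfalso
  have hik' : i + 1 ≠ k + 1 := fun h => hik (add_right_cancel h)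
  have hV := gap_dbl O hzw
  have hVl : arcLen (dbl z) (dbl w) = 2 * arcLen z w - 1 := by
    rcases arcLen_dbl z w with h1 | h1
    · linarith
    · exact h1.2
  have hpos : ∀ a ∈ O.A (k + 1), 0 < arcLen (dbl z) a := fun a ha =>
    arcLen_pos (portrait_disjoint O hik' hV.1 ha)
  have hne : ∀ a ∈ O.A (k + 1), arcLen (dbl z) (dbl w) ≠ arcLen (dbl z) a := fun a ha h =>
    portrait_disjoint O hik' hV.2.1 ha (arcLen_inj h)
  by_cases hall : ∀ a ∈ O.A (k + 1), arcLen (dbl z) a < arcLen (dbl z) (dbl w)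
  · have X1 := hall x hx.1
    have X2 := hall x' hx.2.1
    have Y1 := hall y hy.1
    have Y2 := hall y' hy.2.1
    have X3 := hpos x hx.1
    have X4 := hpos x' hx.2.1
    have Y3 := hpos y hy.1
    have Y4 := hpos y' hy.2.1
    have m1 := hx.2.2.2 y hy.1 hxy.symm
    have m2 := hy.2.2.2 x hx.1 hxy
    rcases arcLen_tri (dbl z) x x' with a | a <;> rcases arcLen_tri (dbl z) y y' with b | b <;>
    rcases arcLen_tri (dbl z) x y with c | c <;> rcases arcLen_tri (dbl z) y x with d | d <;>
    linarith [arcLen_pos hxy]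
  · push Not at hall
    obtain ⟨a, ha, hal⟩ := hall
    have hal' := lt_of_le_of_ne hal (hne a ha)
    have hout : ∀ b ∈ O.A (k + 1), arcLen (dbl z) (dbl w) < arcLen (dbl z) b := by
      intro b hb
      by_contra hb'
      push Not at hb'
      have hb'' := lt_of_le_of_ne hb' (hne b hb).symm
      exact crossing (O.hullDisjoint _ _ hik') hV.1 hV.2.1 hb ha (hpos b hb) hb'' hal'
    have T := hout _ ((O.bijOn k).mapsTo ht0.1)
    have T' := hout _ ((O.bijOn k).mapsTo ht0.2.1)
    have hz1 := arcLen_pos (portrait_disjoint O hik hzw.1 ht0.1)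
    have hz2 := arcLen_pos (portrait_disjoint O hik hzw.1 ht0.2.1)
    have c1 : ¬ (arcLen z t0 < arcLen z w ∧ arcLen z w < arcLen z t0') := fun h =>
      crossing (O.hullDisjoint _ _ hik) hzw.1 hzw.2.1 ht0.1 ht0.2.1 hz1 h.1 h.2
    have c2 : ¬ (arcLen z t0' < arcLen z w ∧ arcLen z w < arcLen z t0) := fun h =>
      crossing (O.hullDisjoint _ _ hik) hzw.1 hzw.2.1 ht0.2.1 ht0.1 hz2 h.1 h.2
    have hm := hmin _ _ _ hV
    have b1 := arcLen_lt_one z t0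
    have b2 := arcLen_lt_one z t0'
    rcases arcLen_dbl z t0 with a | a <;> rcases arcLen_dbl z t0' with b | b <;>
    rcases arcLen_tri z t0 t0' with c | c
    · linarith
    · linarith
    · exact c1 ⟨by linarith, by linarith⟩
    · linarith
    · linarith
    · exact c2 ⟨by linarith, by linarith⟩
    · linarith
    · linarith

end portrait

lemma portrait_period {p r : ℕ} (O : FormalOrbitPortrait p r) {j : ZMod p}
    {x : AddCircle (1 : ℝ)} (hx : x ∈ O.A j) : dbl^[r * p] x = x := by
  have := Function.isPeriodicPt_minimalPeriod dbl x
  rw [O.period j x hx] at this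
  exact this

/-- If all angles of a formal orbit portrait have exact period `r·p` and the valence is `v`,
then either `v = r`, or `v = 2` and `r = 1`. -/
theorem formalOrbitPortrait_valence (p r v : ℕ) (O : FormalOrbitPortrait p r)
    (hv : ∀ j, (O.A j).ncard = v) :
    v = r ∨ (v = 2 ∧ r = 1) := by
  classical
  have hp := O.hp
  have hr := O.hr
  have hret : ∀ j, ∀ x ∈ O.A j, dbl^[p] x ∈ O.A j := by
    intro j x hx
    simpa using portrait_iter O p hx
  have hfix : ∀ j, ∀ x ∈ O.A j, dbl^[p] x = x → r = 1 := by
    intro j x hx h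
    have h1 : Function.minimalPeriod dbl x ∣ p := Function.IsPeriodicPt.minimalPeriod_dvd h
    rw [O.period j x hx] at h1
    have h2 := Nat.le_of_dvd hp h1
    have : r * p ≤ 1 * p := by simpa using h2
    have := Nat.le_of_mul_le_mul_right this hp
    omega
  by_cases hn : ∀ j, (O.A j).Nontrivial
  swap
  · left
    push Not at hn
    obtain ⟨j, hj⟩ := hn
    obtain ⟨x, hx⟩ := O.nonempty j
    have h1 : v = 1 := by
      rw [← hv j, Set.ncard_eq_one]
      exact ⟨x, hj.eq_singleton_of_mem hx⟩
    rw [h1, hfix j x hx (hj (hret j x hx) hx)]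
  obtain ⟨j, t, t', ht, hmin⟩ := exists_min_gap O hn
  obtain ⟨k, rfl⟩ : ∃ k, j = k + 1 := ⟨j - 1, by ring⟩
  obtain ⟨S, hS⟩ : ∃ S : Finset (AddCircle (1 : ℝ)),
    S = (Finset.range r).image (fun i => dbl^[p * i] t) := ⟨_, rfl⟩
  have hScard : S.card = r := by
    rw [hS, Finset.card_image_of_injOn, Finset.card_range]
    intro a ha b hb hab
    simp only [Finset.coe_range, Set.mem_Iio] at ha hb
    have hlt : ∀ c, c < r → p * c < Function.minimalPeriod dbl t := by
      intro c hc
      rw [O.period _ t ht.1, mul_comm]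
      exact Nat.mul_lt_mul_of_pos_right hc hp
    have := (Function.iterate_eq_iterate_iff_of_lt_minimalPeriod (hlt a ha) (hlt b hb)).1 hab
    exact Nat.eq_of_mul_eq_mul_left hp this
  have hSmem : ∀ m, dbl^[m] t ∈ O.A (k + 1) → dbl^[m] t ∈ S := by
    intro m hm
    have h1 := portrait_iter O m ht.1
    have h2 : k + 1 + (m : ZMod p) = k + 1 := by
      by_contra hne
      exact portrait_disjoint O hne h1 hm rfl
    have h3 : (m : ZMod p) = 0 := by simpa using h2
    rw [ZMod.natCast_eq_zero_iff] at h3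
    obtain ⟨c, rfl⟩ := h3
    rw [hS, Finset.mem_image]
    refine ⟨c % r, Finset.mem_range.2 (Nat.mod_lt _ hr), ?_⟩
    have h4 := Function.iterate_mod_minimalPeriod_eq (f := dbl) (x := t) (n := p * c)
    rw [O.period _ t ht.1, mul_comm r p, Nat.mul_mod_mul_left] at h4
    exact h4
  have hSsub : (S : Set (AddCircle (1 : ℝ))) ⊆ O.A (k + 1) := by
    intro x hx
    rw [hS] at hx
    simp only [Finset.coe_image, Set.mem_image] at hx
    obtain ⟨i, -, rfl⟩ := hx
    have := portrait_iter O (p * i) ht.1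
    simpa using this
  have htS : t ∈ S := hSmem 0 ht.1
  have hone : ∀ x ∈ O.A (k + 1), ∀ y ∈ O.A (k + 1), x ∉ S → y ∉ S → x = y := by
    intro x hx y hy hxS hyS
    by_contra hne
    obtain ⟨x', hx'⟩ := exists_isGap (O.finite _) (hn _) hx
    obtain ⟨y', hy'⟩ := exists_isGap (O.finite _) (hn _) hy
    rcases le_total (arcLen x x') (arcLen y y') with h | h
    · obtain ⟨m, rfl⟩ := key_step O hn ht hmin hx' hy' hne h
      exact hxS (hSmem m hx)
    · obtain ⟨m, rfl⟩ := key_step O hn ht hmin hy' hx' (Ne.symm hne) h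
      exact hyS (hSmem m hy)
  by_cases hall : O.A (k + 1) ⊆ S
  · left
    rw [← hv (k + 1), Set.Subset.antisymm hall hSsub, Set.ncard_coe_finset, hScard]
  right
  obtain ⟨x, hx, hxS⟩ := Set.not_subset.1 hall
  have hxS' : x ∉ S := hxS
  have hdx : dbl^[p] x ∉ S := by
    intro h
    rw [hS, Finset.mem_image] at h
    obtain ⟨i, -, hi⟩ := h
    have e : x = dbl^[(r - 1) * p + p * i] t := by
      rw [Function.iterate_add_apply, hi, ← Function.iterate_add_apply]
      have : (r - 1) * p + p = r * p := by
        obtain ⟨q, rfl⟩ : ∃ q, r = q + 1 := ⟨r - 1, by omega⟩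
        simp
        ring
      rw [this, portrait_period O hx]
    apply hxS'
    rw [e]
    apply hSmem
    rw [← e]
    exact hx
  have hr1 := hfix _ x hx (hone _ (hret _ x hx) _ hx hdx hxS')
  refine ⟨?_, hr1⟩
  have hA : O.A (k + 1) = ((insert x S : Finset (AddCircle (1 : ℝ))) : Set _) := by
    ext y
    simp only [Finset.coe_insert, Set.mem_insert_iff]
    constructor
    · intro hy
      by_cases hyS : y ∈ S
      · exact Or.inr hyS
      · exact Or.inl (hone y hy x hx hyS hxS')
    · rintro (rfl | h)
      · exact hx
      · exact hSsub h
  rw [← hv (k + 1), hA, Set.ncard_coe_finset, Finset.card_insert_of_notMem hxS', hScard, hr1]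
end
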